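/- Let Γ be a non-elementary hyperbolic group and S, S⋆ two finite symmetric generating sets. Then τ(S⋆/S) ≥ gr(S)/gr(S⋆), and equality τ(S⋆/S) = gr(S)/gr(S⋆) holds if and only if the word metrics d_{S⋆} and d_S are roughly similar, i.e. there exist constants τ > 0 and D ≥ 0 such that |d_{S⋆}(x,y) − τ·d_S(x,y)| ≤ D for all x, y ∈ Γ. -/

import Mathlib

open MeasureTheory Filter Topology
open scoped ENNReal NNReal

noncomputable section

namespace HypFlow

/-! ## Word metrics, hyperbolic metrics on groups, growth rates -/

variable {Γ : Type*}

/-- Word length of a group element with respect to a generating set `S`. -/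
def wordLength [Group Γ] (S : Set Γ) (x : Γ) : ℕ :=
  sInf {n : ℕ | ∃ l : List Γ, (∀ a ∈ l, a ∈ S) ∧ l.length = n ∧ l.prod = x}

/-- Word metric associated with a generating set `S`. -/
def wordDist [Group Γ] (S : Set Γ) (x y : Γ) : ℝ :=
  (wordLength S (x⁻¹ * y) : ℝ)

/-- `S` is a finite symmetric generating set. -/
def IsSymmGen [Group Γ] (S : Set Γ) : Prop :=
  S.Finite ∧ (∀ s ∈ S, s⁻¹ ∈ S) ∧ Subgroup.closure S = ⊤

/-- Gromov product of `x, y` based at `w` for the metric `d`. -/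
def gromov (d : Γ → Γ → ℝ) (w x y : Γ) : ℝ := (d w x + d w y - d x y) / 2

/-- `d` is a (genuine) metric on `Γ`. -/
structure IsMetric (d : Γ → Γ → ℝ) : Prop where
  refl : ∀ x, d x x = 0
  pos : ∀ x y, x ≠ y → 0 < d x y
  symm : ∀ x y, d x y = d y x
  triangle : ∀ x y z, d x z ≤ d x y + d y z

/-- `d` is `δ`-hyperbolic for some `δ ≥ 0` (Gromov product form). -/
def IsHyperbolicMetric (d : Γ → Γ → ℝ) : Prop :=
  ∃ δ : ℝ, 0 ≤ δ ∧ ∀ w x y z : Γ, min (gromov d w x z) (gromov d w z y) - δ ≤ gromov d w x y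

/-- Two metrics are quasi-isometric. -/
def QuasiIsometric (d₁ d₂ : Γ → Γ → ℝ) : Prop :=
  ∃ L C : ℝ, 0 < L ∧ 0 ≤ C ∧ ∀ x y : Γ,
    d₁ x y / L - C ≤ d₂ x y ∧ d₂ x y ≤ L * d₁ x y + C

/-- `d` belongs to `𝒟_Γ`: a left-invariant hyperbolic metric quasi-isometric to a
word metric. -/
structure InD [Group Γ] (d : Γ → Γ → ℝ) : Prop where
  metric : IsMetric d
  leftInv : ∀ g x y : Γ, d (g * x) (g * y) = d x y
  hyp : IsHyperbolicMetric d
  qi : ∃ S : Set Γ, IsSymmGen S ∧ QuasiIsometric (wordDist S) d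

/-- Strong hyperbolicity (Nica–Špakula / Mineyev). -/
def IsStronglyHyperbolic (d : Γ → Γ → ℝ) : Prop :=
  ∃ L s R₀ : ℝ, 0 ≤ L ∧ 0 < s ∧ 0 ≤ R₀ ∧
    ∀ (x x' y y' : Γ) (R : ℝ), R₀ ≤ R →
      R ≤ d x y - d x x' - d y y' + d x' y' →
      |d x y - d x' y - d x y' + d x' y'| ≤ L * Real.exp (-s * R)

/-- Exponential volume growth rate `gr(d)` of `(Γ, d)` based at the identity. -/
def growthRate [Group Γ] (d : Γ → Γ → ℝ) : ℝ :=
  limsup (fun n : ℕ => Real.log (Nat.card {x : Γ // d 1 x ≤ (n : ℝ)}) / (n : ℝ)) atTop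

/-- `Γ` is virtually cyclic. -/
def VirtuallyCyclic (Γ : Type*) [Group Γ] : Prop :=
  ∃ H : Subgroup Γ, H.FiniteIndex ∧ ∃ g : Γ, H = Subgroup.zpowers g

/-- `Γ` is a non-elementary hyperbolic group: some (equivalently, any) word metric is
hyperbolic and `Γ` is not virtually cyclic. -/
def NonElemHyperbolic (Γ : Type*) [Group Γ] : Prop :=
  (∃ S : Set Γ, IsSymmGen S ∧ IsHyperbolicMetric (wordDist S)) ∧ ¬ VirtuallyCyclic Γ

/-! ## Mean distortion -/

/-- Cardinality of the word sphere `𝐒_n`. -/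
def sphCard [Group Γ] (S : Set Γ) (n : ℕ) : ℕ :=
  Nat.card {x : Γ // wordLength S x = n}

/-- Average `S⋆`-word length over the `S`-sphere of radius `n`. -/
def meanLen [Group Γ] (S Sst : Set Γ) (n : ℕ) : ℝ :=
  (∑' x : {x : Γ // wordLength S x = n}, (wordLength Sst (x : Γ) : ℝ)) / (sphCard S n : ℝ)

/-- Mean distortion `τ(S⋆/S)`. -/
def meanDistortion [Group Γ] (S Sst : Set Γ) : ℝ :=
  liminf (fun n : ℕ => meanLen S Sst n / (n : ℝ)) atTop

/-! ## Hausdorff measures and dimension with respect to a gauge -/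

/-- Diameter of a set with respect to a gauge `ρ`. -/
def gdiam {X : Type*} (ρ : X → X → ℝ) (E : Set X) : ℝ≥0∞ :=
  ⨆ x ∈ E, ⨆ y ∈ E, ENNReal.ofReal (ρ x y)

/-- Pre-Hausdorff content at scale `Δ`. -/
def hMeasAux {X : Type*} (ρ : X → X → ℝ) (D : ℝ) (Δ : ℝ≥0∞) (E : Set X) : ℝ≥0∞ :=
  ⨅ (c : ℕ → Set X) (_ : E ⊆ ⋃ n, c n) (_ : ∀ n, gdiam ρ (c n) ≤ Δ),
    ∑' n, gdiam ρ (c n) ^ D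

/-- `D`-dimensional Hausdorff measure of a set relative to the gauge `ρ`. -/
def hMeas {X : Type*} (ρ : X → X → ℝ) (D : ℝ) (E : Set X) : ℝ≥0∞ :=
  ⨆ (Δ : ℝ≥0∞) (_ : 0 < Δ), hMeasAux ρ D Δ E

/-- Hausdorff dimension of a set relative to the gauge `ρ`. -/
def hDim {X : Type*} (ρ : X → X → ℝ) (E : Set X) : ℝ :=
  sSup {D : ℝ | 0 ≤ D ∧ hMeas ρ D E ≠ 0}

/-- Lower Hausdorff dimension of a measure. -/
def lowerHDim {X : Type*} [MeasurableSpace X] (ρ : X → X → ℝ) (ν : Measure X) : ℝ :=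
  sInf {r : ℝ | ∃ E : Set X, MeasurableSet E ∧ 0 < ν E ∧ hDim ρ E = r}

/-- Upper Hausdorff dimension of a measure. -/
def upperHDim {X : Type*} [MeasurableSpace X] (ρ : X → X → ℝ) (ν : Measure X) : ℝ :=
  sInf {r : ℝ | ∃ E : Set X, MeasurableSet E ∧ ν Eᶜ = 0 ∧ hDim ρ E = r}

/-- Radon measure: finite on compacts and outer regular. -/
def IsRadon {X : Type*} [TopologicalSpace X] [MeasurableSpace X] (ν : Measure X) : Prop :=
  (∀ K : Set X, IsCompact K → ν K < ⊤) ∧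
  (∀ A : Set X, MeasurableSet A → ν A = ⨅ (U : Set X) (_ : IsOpen U) (_ : A ⊆ U), ν U)

/-! ## Abstract boundary data for a hyperbolic metric on `Γ` -/

/-- The Gromov boundary of `(Γ, d)` packaged abstractly: a compact space `B` with a
continuous `Γ`-action, the extension of the Gromov product (based at the identity `o`)
to pairs of boundary points (`gpb`) and to a group element and a boundary point (`gpx`),
satisfying hyperbolicity, the characteristic identities of Busemann functions and the
expected continuity properties. -/
structure BoundaryData (Γ : Type*) [Group Γ] (d : Γ → Γ → ℝ)
    (B : Type*) [TopologicalSpace B] where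
  act : Γ → B → B
  act_one : ∀ ξ : B, act 1 ξ = ξ
  act_mul : ∀ (x y : Γ) (ξ : B), act (x * y) ξ = act x (act y ξ)
  act_cont : ∀ x : Γ, Continuous (act x)
  gpb : B → B → ℝ
  gpx : Γ → B → ℝ
  gpb_symm : ∀ ξ η : B, gpb ξ η = gpb η ξ
  gpb_nonneg : ∀ ξ η : B, 0 ≤ gpb ξ η
  gpx_nonneg : ∀ (x : Γ) (ξ : B), 0 ≤ gpx x ξ
  gpb_cont : ContinuousOn (fun p : B × B => gpb p.1 p.2) {p : B × B | p.1 ≠ p.2}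
  gpx_cont : ∀ x : Γ, Continuous (gpx x)
  hyp : ∃ δ : ℝ, 0 ≤ δ ∧
    (∀ ξ η ζ : B, min (gpb ξ ζ) (gpb ζ η) - δ ≤ gpb ξ η) ∧
    (∀ (x : Γ) (ξ η : B), min (gpx x ξ) (gpb ξ η) - δ ≤ gpx x η) ∧
    (∀ (x y : Γ) (ξ : B), min (gromov d 1 x y) (gpx y ξ) - δ ≤ gpx x ξ)
  at_infinity : ∀ (ξ : B) (M : ℝ), ∃ x : Γ, M ≤ gpx x ξ
  conformal : ∃ C : ℝ, 0 ≤ C ∧ ∀ (x : Γ) (ξ η : B), ξ ≠ η →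
    |((d 1 x - 2 * gpx x ξ) + (d 1 x - 2 * gpx x η))
        - (2 * gpb (act x⁻¹ ξ) (act x⁻¹ η) - 2 * gpb ξ η)| ≤ C

variable {B : Type*}

/-- The boundary square `∂²Γ`: pairs of distinct boundary points. -/
abbrev B2 (B : Type*) := {p : B × B // p.1 ≠ p.2}

/-- Busemann cocycle for a strongly hyperbolic metric:
`b_o(x, ξ) = d(o, x) - 2⟨x|ξ⟩_o`. -/
def busemann [Group Γ] {d : Γ → Γ → ℝ} [TopologicalSpace B]
    (bd : BoundaryData Γ d B) (x : Γ) (ξ : B) : ℝ :=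
  d 1 x - 2 * bd.gpx x ξ

/-- Busemann function of a general metric `d ∈ 𝒟_Γ`:
`b_o(x, ξ) = sup { limsup_n (d(x, z_n) - d(o, z_n)) : z_n → ξ }`. -/
def busemannSup [Group Γ] {d : Γ → Γ → ℝ} [TopologicalSpace B]
    (bd : BoundaryData Γ d B) (x : Γ) (ξ : B) : ℝ :=
  sSup {t : ℝ | ∃ z : ℕ → Γ,
    Tendsto (fun n => bd.gpx (z n) ξ) atTop atTop ∧
    t = limsup (fun n => d x (z n) - d 1 (z n)) atTop}

open Classical in
/-- The gauge `ρ(ξ, η) = exp(-(ξ|η)_o)` on the boundary. -/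
def gaugeB [Group Γ] {d : Γ → Γ → ℝ} [TopologicalSpace B]
    (bd : BoundaryData Γ d B) (ξ η : B) : ℝ :=
  if ξ = η then 0 else Real.exp (-(bd.gpb ξ η))

/-- The max-gauge `ρ_×` on the boundary square. -/
def gaugeX [Group Γ] {d : Γ → Γ → ℝ} [TopologicalSpace B]
    (bd : BoundaryData Γ d B) (p q : B2 B) : ℝ :=
  max (gaugeB bd p.1.1 q.1.1) (gaugeB bd p.1.2 q.1.2)

/-- Diagonal action of `Γ` on the boundary square. -/
def BoundaryData.dact [Group Γ] {d : Γ → Γ → ℝ} [TopologicalSpace B]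
    (bd : BoundaryData Γ d B) (g : Γ) (p : B2 B) : B2 B :=
  ⟨(bd.act g p.1.1, bd.act g p.1.2), fun h => p.2 (by
    have h' : bd.act g p.1.1 = bd.act g p.1.2 := h
    have h2 : ∀ ξ : B, bd.act g⁻¹ (bd.act g ξ) = ξ := fun ξ => by
      rw [← bd.act_mul, inv_mul_cancel, bd.act_one]
    have h3 := congrArg (bd.act g⁻¹) h'
    rwa [h2, h2] at h3)⟩

/-- Patterson–Sullivan property: quasi-conformal density of dimension `gr(d)` with
respect to the Busemann function `bus`. -/
def IsPS [Group Γ] [TopologicalSpace B] [MeasurableSpace B] {d : Γ → Γ → ℝ}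
    (bd : BoundaryData Γ d B) (bus : Γ → B → ℝ) (μ : Measure B) : Prop :=
  IsProbabilityMeasure μ ∧ ∃ C : ℝ, 1 ≤ C ∧ ∀ x : Γ,
    Measure.map (bd.act x) μ
        ≤ μ.withDensity (fun ξ => ENNReal.ofReal (C * Real.exp (-(growthRate d) * bus x ξ))) ∧
    μ.withDensity (fun ξ => ENNReal.ofReal (C⁻¹ * Real.exp (-(growthRate d) * bus x ξ)))
        ≤ Measure.map (bd.act x) μ

/-- Product measure on the boundary square (restriction of `μ ⊗ ν` off the diagonal). -/
def prodB2 [TopologicalSpace B] [MeasurableSpace B] (μ ν : Measure B) : Measure (B2 B) :=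
  Measure.comap Subtype.val (μ.prod ν)

/-- The Bowen–Margulis current `exp(2·gr(d)·⟨ξ|η⟩_o)·(μ ⊗ μ)` on `∂²Γ`. -/
def bmCurrent [Group Γ] [TopologicalSpace B] [MeasurableSpace B] {d : Γ → Γ → ℝ}
    (bd : BoundaryData Γ d B) (μ : Measure B) : Measure (B2 B) :=
  (prodB2 μ μ).withDensity
    (fun p => ENNReal.ofReal (Real.exp (2 * growthRate d * bd.gpb p.1.1 p.1.2)))

/-! ## The topological flow space -/

/-- The cocycle `α(x, ξ, η) = (b_o(x⁻¹, ξ) - b_o(x⁻¹, η))/2`. -/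
def alphaC [Group Γ] [TopologicalSpace B] {d : Γ → Γ → ℝ}
    (bd : BoundaryData Γ d B) (x : Γ) (p : B2 B) : ℝ :=
  (busemann bd x⁻¹ p.1.1 - busemann bd x⁻¹ p.1.2) / 2

/-- The `(Γ, α)`-action on `∂²Γ × ℝ`:
`x·(ξ, η, t) = (xξ, xη, t - α(x, ξ, η))`. -/
def gact [Group Γ] [TopologicalSpace B] {d : Γ → Γ → ℝ}
    (bd : BoundaryData Γ d B) (x : Γ) : B2 B × ℝ → B2 B × ℝ :=
  fun q => (bd.dact x q.1, q.2 - alphaC bd x q.1)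

/-- Orbit relation of the `(Γ, α)`-action. -/
def orbitRel [Group Γ] [TopologicalSpace B] {d : Γ → Γ → ℝ}
    (bd : BoundaryData Γ d B) : (B2 B × ℝ) → (B2 B × ℝ) → Prop :=
  fun p q => ∃ x : Γ, gact bd x p = q

/-- The topological flow space `ℱ_α = Γ \ (∂²Γ × ℝ)`. -/
abbrev FlowSpace [Group Γ] [TopologicalSpace B] {d : Γ → Γ → ℝ}
    (bd : BoundaryData Γ d B) :=
  Quot (orbitRel bd)

/-- The topological flow `Φ_t` on `ℱ_α` induced by translation in the `ℝ`-coordinate. -/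
def flowQ [Group Γ] [TopologicalSpace B] {d : Γ → Γ → ℝ}
    (bd : BoundaryData Γ d B) (t : ℝ) : FlowSpace bd → FlowSpace bd :=
  Quot.map (fun p => (p.1, p.2 + t)) (by
    rintro p q ⟨x, rfl⟩
    refine ⟨x, ?_⟩
    have h4 : p.2 + t - alphaC bd x p.1 = p.2 - alphaC bd x p.1 + t := by ring
    exact congrArg (Prod.mk (bd.dact x p.1)) h4)

/-- Representative of a point of a quotient. -/
def qout {α : Type*} {r : α → α → Prop} (q : Quot r) : α :=
  (Quot.exists_rep q).choose

/-! ## Automatic structures and symbolic dynamics -/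

/-- A finite labelled directed graph (automaton) over the alphabet `S ⊆ Γ`. -/
structure Automaton (Γ : Type*) (S : Set Γ) where
  V : Type
  E : Type
  fintypeV : Fintype V
  fintypeE : Fintype E
  src : E → V
  tgt : E → V
  init : V
  lab : E → Γ
  lab_mem : ∀ e, lab e ∈ S

attribute [instance] Automaton.fintypeV Automaton.fintypeE

namespace Automaton

variable {S : Set Γ}

/-- A list of edges is a directed path. -/
def Chain (A : Automaton Γ S) : List A.E → Prop
  | [] => True
  | [_] => True
  | e :: e' :: l => A.tgt e = A.src e' ∧ Chain A (e' :: l)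

/-- A path starts at the initial state. -/
def FromInit (A : Automaton Γ S) (l : List A.E) : Prop :=
  ∀ h : l ≠ [], A.src (l.head h) = A.init

/-- The group element labelled by a path. -/
def pathProd [Group Γ] (A : Automaton Γ S) (l : List A.E) : Γ :=
  (l.map A.lab).prod

/-- A path stays in the set of vertices `W`. -/
def ChainIn (A : Automaton Γ S) (W : Set A.V) (l : List A.E) : Prop :=
  A.Chain l ∧ ∀ e ∈ l, A.src e ∈ W ∧ A.tgt e ∈ W

/-- `w` can be reached from `v` by a directed path inside `W`. -/
def Reaches (A : Automaton Γ S) (W : Set A.V) (v w : A.V) : Prop :=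
  v = w ∨ ∃ (l : List A.E) (h : l ≠ []), A.ChainIn W l ∧
    A.src (l.head h) = v ∧ A.tgt (l.getLast h) = w

/-- The subgraph on `W` is recurrent. -/
def IsRecurrentOn (A : Automaton Γ S) (W : Set A.V) : Prop :=
  ∀ v ∈ W, ∀ w ∈ W, A.Reaches W v w

/-- A component: a maximal recurrent subgraph. -/
def IsComponent (A : Automaton Γ S) (W : Set A.V) : Prop :=
  W.Nonempty ∧ A.IsRecurrentOn W ∧
    ∀ W' : Set A.V, W ⊆ W' → A.IsRecurrentOn W' → W' = W

end Automaton

/-- A strongly Markov automatic structure (Cannon): all vertices are reachable from the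
initial state, paths label geodesics in the Cayley graph, and evaluation is a bijection
from directed paths from the initial state onto `Γ`. -/
structure IsStronglyMarkov [Group Γ] {S : Set Γ} (A : Automaton Γ S) : Prop where
  reach : ∀ v : A.V, ∃ l : List A.E, A.Chain l ∧ A.FromInit l ∧
    ((l = [] ∧ v = A.init) ∨ ∃ h : l ≠ [], A.tgt (l.getLast h) = v)
  geodesic : ∀ l : List A.E, A.Chain l → wordLength S (A.pathProd l) = l.length
  endpoint_bij : Function.Bijective
    (fun l : {l : List A.E // A.Chain l ∧ A.FromInit l} => A.pathProd l.1)

instance {S : Set Γ} (A : Automaton Γ S) : MeasurableSpace A.E := ⊤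
instance {S : Set Γ} (A : Automaton Γ S) : TopologicalSpace A.E := ⊥

/-- The two-sided subshift of finite type of bi-infinite directed paths in `A`. -/
abbrev BiPath {S : Set Γ} (A : Automaton Γ S) :=
  {ω : ℤ → A.E // ∀ i : ℤ, A.tgt (ω i) = A.src (ω (i + 1))}

/-- The shift `σ` on bi-infinite paths. -/
def shiftB {S : Set Γ} (A : Automaton Γ S) (ω : BiPath A) : BiPath A :=
  ⟨fun i => ω.1 (i + 1), fun i => ω.2 (i + 1)⟩

open Classical in
/-- The metric `d_Σ(ω, ω') = e^{-n}`, `n = sup{k : ω_i = ω'_i for |i| ≤ k}`. -/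
def dSigma {S : Set Γ} {A : Automaton Γ S} (ω ω' : BiPath A) : ℝ :=
  if ω = ω' then 0
  else Real.exp (-((sSup {k : ℕ | ∀ i : ℤ, |i| ≤ (k : ℤ) → ω.1 i = ω'.1 i} : ℕ) : ℝ))

/-- Partial products along the positive ray of a bi-infinite path. -/
def rayPos [Group Γ] {S : Set Γ} (A : Automaton Γ S) (ω : BiPath A) (n : ℕ) : Γ :=
  ((List.range n).map fun i => A.lab (ω.1 (i : ℤ))).prod

/-- Partial products along the negative ray of a bi-infinite path. -/
def rayNeg [Group Γ] {S : Set Γ} (A : Automaton Γ S) (ω : BiPath A) (n : ℕ) : Γ :=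
  ((List.range n).map fun i => (A.lab (ω.1 (-(i : ℤ) - 1)))⁻¹).prod

/-- `wst` is the endpoint map `w_* : Σ → ∂²Γ`: the two labelled geodesic rays of a
bi-infinite path converge to the two components of `wst ω` (convergence to a boundary
point being expressed by divergence of the Gromov product). -/
def IsEndpointMap [Group Γ] {S : Set Γ} (A : Automaton Γ S) [TopologicalSpace B]
    {d : Γ → Γ → ℝ} (bd : BoundaryData Γ d B) (wst : BiPath A → B2 B) : Prop :=
  ∀ ω : BiPath A,
    Tendsto (fun n : ℕ => bd.gpx (rayNeg A ω n) (wst ω).1.1) atTop atTop ∧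
    Tendsto (fun n : ℕ => bd.gpx (rayPos A ω n) (wst ω).1.2) atTop atTop

/-- The function `α̃(ω) = α(w(ω₀)⁻¹, w_*(ω))` on the shift space. -/
def alphaTilde [Group Γ] {S : Set Γ} (A : Automaton Γ S) [TopologicalSpace B]
    {d : Γ → Γ → ℝ} (bd : BoundaryData Γ d B) (wst : BiPath A → B2 B)
    (ω : BiPath A) : ℝ :=
  alphaC bd (A.lab (ω.1 0))⁻¹ (wst ω)

/-- Birkhoff sums on the two-sided shift. -/
def birkhoffB {S : Set Γ} (A : Automaton Γ S) (f : BiPath A → ℝ) (N : ℕ)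
    (ω : BiPath A) : ℝ :=
  ∑ i ∈ Finset.range N, f ((shiftB A)^[i] ω)

/-- The identification generating the suspension flow:
`(ω, t + r(ω)) ∼ (σ^N ω, t)`. -/
def susRel {S : Set Γ} (A : Automaton Γ S) (r : BiPath A → ℝ) (N : ℕ) :
    (BiPath A × ℝ) → (BiPath A × ℝ) → Prop :=
  fun p q => q.1 = (shiftB A)^[N] p.1 ∧ q.2 = p.2 - r p.1

/-- The suspension space `Sus(Σ, r)`. -/
abbrev Sus {S : Set Γ} (A : Automaton Γ S) (r : BiPath A → ℝ) (N : ℕ) :=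
  Quot (susRel A r N)

/-- The suspension flow `σ_t [ω, s] = [ω, s + t]`. -/
def susFlow {S : Set Γ} (A : Automaton Γ S) (r : BiPath A → ℝ) (N : ℕ) (t : ℝ) :
    Sus A r N → Sus A r N :=
  Quot.map (fun p => (p.1, p.2 + t)) (by
    rintro p q ⟨h1, h2⟩
    have h3 : q.2 + t = (p.2 + t) - r p.1 := by rw [h2]; ring
    exact ⟨h1, h3⟩)

/-- The set `Σ_𝒞` of bi-infinite paths staying in the component `W` for all time. -/
def SigmaC {S : Set Γ} (A : Automaton Γ S) (W : Set A.V) : Set (BiPath A) :=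
  {ω | ∀ i : ℤ, A.src (ω.1 i) ∈ W}

/-- The cylinder in `Σ_𝒞` determined by a finite word. -/
def cylSet {S : Set Γ} (A : Automaton Γ S) (W : Set A.V) (n : ℕ)
    (w : Fin n → A.E) : Set (BiPath A) :=
  {ω | ω ∈ SigmaC A W ∧ ∀ i : Fin n, ω.1 ((i : ℕ) : ℤ) = w i}

/-- The cylinder of length `n` of a given bi-infinite path (coordinates `0, …, n-1`). -/
def cylPos {S : Set Γ} (A : Automaton Γ S) (n : ℕ) (ω : BiPath A) :
    Set (BiPath A) :=
  {ω' | ∀ i : ℕ, i < n → ω'.1 (i : ℤ) = ω.1 (i : ℤ)}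

/-- The pressure of a potential on the component `W` of the two-sided shift, via
partition sums over cylinders. -/
def prC {S : Set Γ} (A : Automaton Γ S) (W : Set A.V) (ψ : BiPath A → ℝ) : ℝ :=
  limsup (fun n : ℕ =>
    Real.log (∑' w : {w : Fin n → A.E // (cylSet A W n w).Nonempty},
      Real.exp (sSup (birkhoffB A ψ n '' cylSet A W n w.1))) / (n : ℝ)) atTop

/-- Birkhoff sums of a potential on finite unilateral paths. -/
def finBirk {S : Set Γ} (A : Automaton Γ S) (φ : List A.E → ℝ) (l : List A.E) : ℝ :=
  ∑ k ∈ Finset.range l.length, φ (l.drop k)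

/-- The pressure (logarithm of the maximal modulus of the eigenvalues of the transfer
operator `ℒ_φ` restricted to the component `W`), expressed through the partition sums
over finite paths staying in `W`. -/
def prCfin {S : Set Γ} (A : Automaton Γ S) (W : Set A.V) (φ : List A.E → ℝ) : ℝ :=
  limsup (fun n : ℕ =>
    Real.log (∑' l : {l : List A.E // A.ChainIn W l ∧ l.length = n},
      Real.exp (finBirk A φ l.1)) / (n : ℝ)) atTop

/-- The potential `b̃` on finite unilateral paths:
`b̃(ω) = b̂_o(w(ω₀), w_* ω) = d(w(ω₀), w_* ω) - d(o, w_* ω)`. -/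
def potB [Group Γ] {S : Set Γ} (A : Automaton Γ S) (d : Γ → Γ → ℝ) :
    List A.E → ℝ
  | [] => 0
  | e :: l' => d (A.lab e) (A.pathProd (e :: l')) - d 1 (A.pathProd (e :: l'))

/-! ## Kolmogorov–Sinai entropy -/

/-- A finite measurable partition. -/
def IsFinPartition {X : Type*} [MeasurableSpace X] {k : ℕ} (P : Fin k → Set X) : Prop :=
  (∀ i, MeasurableSet (P i)) ∧ Pairwise (Function.onFun Disjoint P) ∧
    (⋃ i, P i) = Set.univ

/-- Entropy of a finite partition. -/
def partEnt {X : Type*} [MeasurableSpace X] {ι : Type*} [Fintype ι]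
    (ν : Measure X) (P : ι → Set X) : ℝ :=
  -∑ i, ((ν (P i)).toReal * Real.log (ν (P i)).toReal)

/-- The join `⋁_{i<n} T^{-i} P`. -/
def joinPart {X : Type*} (T : X → X) {k : ℕ} (P : Fin k → Set X) (n : ℕ)
    (f : Fin n → Fin k) : Set X :=
  ⋂ i : Fin n, T^[(i : ℕ)] ⁻¹' P (f i)

/-- Kolmogorov–Sinai (measure-theoretic) entropy of `T` with respect to `ν`. -/
def ksEntropy {X : Type*} [MeasurableSpace X] (T : X → X) (ν : Measure X) : ℝ :=
  sSup {h : ℝ | ∃ (k : ℕ) (P : Fin k → Set X), IsFinPartition P ∧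
    h = liminf (fun n : ℕ => partEnt ν (joinPart T P n) / (n : ℝ)) atTop}

end HypFlow

end

namespace HypFlow

variable {Γ : Type*} [Group Γ]

/-- A proper geodesic length function on a group. -/
structure IsLength (ℓ : Γ → ℕ) : Prop where
  one : ℓ 1 = 0
  eq_one : ∀ x, ℓ x = 0 → x = 1
  inv : ∀ x, ℓ x⁻¹ = ℓ x
  mul : ∀ x y, ℓ (x * y) ≤ ℓ x + ℓ y
  fin : ∀ n, {x | ℓ x ≤ n}.Finite
  split : ∀ x i, i ≤ ℓ x → ∃ p q, p * q = x ∧ ℓ p = i ∧ i + ℓ q = ℓ x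

/-- The left-invariant distance of a length function. -/
def lenDist (ℓ : Γ → ℕ) (x y : Γ) : ℕ := ℓ (x⁻¹ * y)

/-- The four-point hyperbolicity condition. -/
def FourPoint (ℓ : Γ → ℕ) (δ : ℕ) : Prop := ∀ x y z w : Γ,
  lenDist ℓ x y + lenDist ℓ z w ≤ lenDist ℓ x z + lenDist ℓ y w + 2 * δ ∨
  lenDist ℓ x y + lenDist ℓ z w ≤ lenDist ℓ x w + lenDist ℓ y z + 2 * δ

namespace IsLength

variable {ℓ : Γ → ℕ} (h : IsLength ℓ)
include h

lemma dist_self (x : Γ) : lenDist ℓ x x = 0 := by simp [lenDist, h.one]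

lemma dist_comm (x y : Γ) : lenDist ℓ x y = lenDist ℓ y x := by
  rw [lenDist, ← h.inv]; simp [lenDist]

lemma dist_triangle (x y z : Γ) : lenDist ℓ x z ≤ lenDist ℓ x y + lenDist ℓ y z := by
  have := h.mul (x⁻¹ * y) (y⁻¹ * z)
  simpa [lenDist, mul_assoc] using this

omit h in
lemma dist_left (g x y : Γ) : lenDist ℓ (g * x) (g * y) = lenDist ℓ x y := by
  simp [lenDist, mul_assoc]

omit h in
lemma dist_one_left (x : Γ) : lenDist ℓ 1 x = ℓ x := by simp [lenDist]

omit h in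
lemma dist_mul_right (x y : Γ) : lenDist ℓ x (x * y) = ℓ y := by simp [lenDist]

/-- Two points close to a geodesic from `1` to `z` at comparable heights are close. -/
lemma near_geodesic {δ : ℕ} (hδ : FourPoint ℓ δ) {a b z : Γ} {C : ℕ}
    (ha : ℓ a + lenDist ℓ a z ≤ ℓ z + C) (hb : ℓ b + lenDist ℓ b z ≤ ℓ z + C) :
    lenDist ℓ a b + ℓ b ≤ ℓ a + C + 2 * δ ∨ lenDist ℓ a b + ℓ a ≤ ℓ b + C + 2 * δ := by
  have := hδ a b 1 z
  rw [h.dist_comm a 1, h.dist_comm b 1] at this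
  simp only [dist_one_left] at this
  omega

/-- Bisection estimate for the Gromov product along a chain of `2 ^ k` steps. -/
lemma chain_product {δ : ℕ} (hδ : FourPoint ℓ δ) (m : Γ) (B : ℕ) :
    ∀ (k : ℕ) (c : ℕ → Γ), (∀ i < 2 ^ k, 2 * B + lenDist ℓ (c i) (c (i + 1)) ≤
        lenDist ℓ m (c i) + lenDist ℓ m (c (i + 1))) →
      2 * B + lenDist ℓ (c 0) (c (2 ^ k)) ≤
        lenDist ℓ m (c 0) + lenDist ℓ m (c (2 ^ k)) + 2 * k * δ := by
  intro k
  induction k with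
  | zero => intro c hc; simpa using hc 0 (by simp)
  | succ k ih =>
    intro c hc
    have h1 := ih c fun i hi => hc i (by rw [pow_succ]; omega)
    have h2 := ih (fun i => c (2 ^ k + i)) fun i hi => by
      have := hc (2 ^ k + i) (by rw [pow_succ]; omega)
      simpa [add_assoc] using this
    have e : 2 ^ (k + 1) = 2 ^ k + 2 ^ k := by rw [pow_succ]; omega
    simp only [add_zero, ← e] at h2
    have h3 := hδ (c 0) (c (2 ^ (k + 1))) m (c (2 ^ k))
    rw [h.dist_comm (c 0) m, h.dist_comm (c (2 ^ (k + 1))) m,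
      h.dist_comm (c (2 ^ (k + 1))) (c (2 ^ k))] at h3
    have e2 : 2 * (k + 1) * δ = 2 * k * δ + 2 * δ := by ring
    omega

/-- A geodesic path from `1` to `z`. -/
lemma exists_path (z : Γ) : ∃ γ : ℕ → Γ, γ 0 = 1 ∧ γ (ℓ z) = z ∧
    ∀ i j, i ≤ j → j ≤ ℓ z → lenDist ℓ (γ i) (γ j) = j - i := by
  obtain ⟨n, hn⟩ : ∃ n, ℓ z = n := ⟨_, rfl⟩
  induction n generalizing z with
  | zero =>
    refine ⟨fun _ => 1, rfl, (h.eq_one z hn).symm, fun i j hij hj => ?_⟩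
    rw [h.dist_self]; omega
  | succ n ih =>
    obtain ⟨p, q, hpq, hp, hq⟩ := h.split z n (by omega)
    obtain ⟨γ, h0, h1, h2⟩ := ih p hp
    rw [hp] at h1 h2
    refine ⟨fun i => if i ≤ n then γ i else z, by simp [h0], by simp [hn], ?_⟩
    intro i j hij hj
    by_cases hjn : j ≤ n
    · simpa [hjn, hij.trans hjn] using h2 i j hij hjn
    · obtain rfl : j = n + 1 := by omega
      by_cases hin : i ≤ n
      · have e1 := h2 i n hin le_rfl
        have e2 := h2 0 i (by omega) hin
        have e3 := h.dist_triangle (γ i) p z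
        have e4 := h.dist_triangle 1 (γ i) z
        have e5 : lenDist ℓ p z = ℓ q := by rw [← hpq, dist_mul_right]
        rw [h0, dist_one_left] at e2
        rw [h1] at e1
        simp only [dist_one_left] at e4
        simp only [hin, if_true, hjn, if_false]
        omega
      · obtain rfl : i = n + 1 := by omega
        simp [h.dist_self]

omit h in
lemma exists_exponent (L δ : ℕ) :
    ∃ R, ∀ D, R ≤ D → ∃ k, 6 * L * D + 2 ≤ 2 ^ k ∧ L + k * δ < D := by
  obtain ⟨k₀, hk₀⟩ : ∃ k₀ : ℕ, ∀ k ≥ k₀, 6 * L * ((2 * δ + 2) * (k + 1)) + 2 ≤ 2 ^ k := by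
    have h1 := (tendsto_pow_const_div_const_pow_of_one_lt 1 (show (1 : ℝ) < 2 by norm_num))
    set A : ℝ := 6 * L * (2 * δ + 2) + 2
    have hA : 0 < A := by positivity
    have h2 := h1.eventually (gt_mem_nhds (show (0 : ℝ) < 1 / (2 * A) by positivity))
    obtain ⟨k₀, hk₀⟩ := eventually_atTop.1 h2
    refine ⟨max k₀ 1, fun k hk => ?_⟩
    have h3 := hk₀ k (le_trans (le_max_left _ _) hk)
    have h4 : (1 : ℝ) ≤ k := by exact_mod_cast (le_trans (le_max_right _ _) hk)
    rw [pow_one, div_lt_div_iff₀ (by positivity) (by positivity)] at h3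
    have h5 : A * (k + 1) ≤ 2 ^ k := by nlinarith
    have h6 : (6 * L * ((2 * δ + 2) * (k + 1)) + 2 : ℝ) ≤ 2 ^ k := by
      refine le_trans ?_ h5
      simp only [A]
      nlinarith
    exact_mod_cast h6
  refine ⟨(2 * δ + 2) * (k₀ + 1) + 2 * L + 1, fun D hD => ⟨D / (2 * δ + 2), ?_, ?_⟩⟩
  · have h1 : k₀ ≤ D / (2 * δ + 2) := by
      rw [Nat.le_div_iff_mul_le (by omega)]
      nlinarith
    refine le_trans ?_ (hk₀ _ h1)
    have h2 : D < (2 * δ + 2) * (D / (2 * δ + 2) + 1) := Nat.lt_mul_div_succ D (by omega)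
    gcongr
  · have h1 : D / (2 * δ + 2) * (2 * δ + 2) ≤ D := Nat.div_mul_le_self _ _
    have h2 : 2 * (D / (2 * δ + 2) * δ) ≤ D := by nlinarith
    omega

/-- Geodesics stay uniformly close to geodesics of a bi-Lipschitz equivalent length. -/
lemma exists_close_to_geodesic {δ : ℕ} (hδ : FourPoint ℓ δ) {ℓ' : Γ → ℕ} (h' : IsLength ℓ')
    (L : ℕ) (hL : ∀ x, ℓ x ≤ L * ℓ' x) (hL' : ∀ x, ℓ' x ≤ L * ℓ x) :
    ∃ R, ∀ z m, ℓ m + lenDist ℓ m z = ℓ z →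
      ∃ p, ℓ' p + lenDist ℓ' p z = ℓ' z ∧ lenDist ℓ m p ≤ R := by
  classical
  obtain ⟨R, hR⟩ := exists_exponent L δ
  refine ⟨R, fun z => ?_⟩
  obtain ⟨γ, h0, h1, h2⟩ := h'.exists_path z
  set N := ℓ' z
  let P : ℕ → Prop := fun D => ∀ m, ℓ m + lenDist ℓ m z = ℓ z →
    ∃ i ≤ N, lenDist ℓ m (γ i) ≤ D
  have hP : ∃ D, P D := ⟨ℓ z, fun m hm => ⟨0, by omega, by
    rw [h0, h.dist_comm, dist_one_left]; omega⟩⟩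
  suffices hD : Nat.find hP ≤ R by
    intro m hm
    obtain ⟨i, hi, hmi⟩ := Nat.find_spec hP m hm
    refine ⟨γ i, ?_, hmi.trans hD⟩
    have e1 := h2 0 i (by omega) hi
    have e2 := h2 i N hi le_rfl
    rw [h0, dist_one_left] at e1
    rw [h1] at e2
    omega
  by_contra hD
  obtain ⟨D, hDdef⟩ : ∃ D, D = Nat.find hP := ⟨_, rfl⟩
  have hPD : P D := hDdef ▸ Nat.find_spec hP
  obtain ⟨k, hk1, hk2⟩ := hR D (by omega)
  have hmin : ¬ P (D - 1) := Nat.find_min hP (by omega)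
  simp only [P, not_forall, not_exists, not_and, not_le] at hmin
  obtain ⟨m, hm, hfar⟩ := hmin
  replace hfar : ∀ i ≤ N, D ≤ lenDist ℓ m (γ i) := fun i hi => by
    have := hfar i hi; omega
  obtain ⟨p, i, hi, hp1, hp2, hp3, hp4⟩ : ∃ p i, i ≤ N ∧ ℓ p + lenDist ℓ p m = ℓ m ∧
      lenDist ℓ p m ≤ 2 * D ∧ lenDist ℓ p (γ i) ≤ D ∧
      (lenDist ℓ p m = 2 * D ∨ p = γ i) := by
    by_cases hc : ℓ m ≤ 2 * D
    · refine ⟨1, 0, by omega, ?_, ?_, ?_, Or.inr h0.symm⟩ <;>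
        simp [h0, dist_one_left, h.one, hc]
    · obtain ⟨p, q, hpq, hp, hq⟩ := h.split m (ℓ m - 2 * D) (by omega)
      have e : lenDist ℓ p m = ℓ q := by rw [← hpq, dist_mul_right]
      have e2 := h.dist_triangle p m z
      have e3 := h.dist_triangle 1 p z
      simp only [dist_one_left] at e3
      obtain ⟨i, hi, hpi⟩ := hPD p (by omega)
      exact ⟨p, i, hi, by omega, by omega, hpi, Or.inl (by omega)⟩
  obtain ⟨q, j, hj, hq1, hq2, hq3, hq4⟩ : ∃ q j, j ≤ N ∧
      lenDist ℓ m q + lenDist ℓ q z = lenDist ℓ m z ∧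
      lenDist ℓ m q ≤ 2 * D ∧ lenDist ℓ q (γ j) ≤ D ∧
      (lenDist ℓ m q = 2 * D ∨ q = γ j) := by
    by_cases hc : lenDist ℓ m z ≤ 2 * D
    · refine ⟨z, N, le_rfl, ?_, hc, ?_, Or.inr h1.symm⟩ <;> simp [h1, h.dist_self]
    · obtain ⟨r, s, hrs, hr, hs⟩ := h.split (m⁻¹ * z) (2 * D) (by
        have : lenDist ℓ m z = ℓ (m⁻¹ * z) := rfl
        omega)
      have e : lenDist ℓ m (m * r) = ℓ r := dist_mul_right m r
      have e4 : lenDist ℓ (m * r) z = ℓ s := by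
        rw [show z = m * r * s by rw [mul_assoc, hrs]; group, dist_mul_right]
      have e5 : lenDist ℓ m z = ℓ (m⁻¹ * z) := rfl
      have e2 := h.dist_triangle 1 m (m * r)
      have e3 := h.dist_triangle 1 (m * r) z
      simp only [dist_one_left] at e2 e3
      obtain ⟨j, hj, hpj⟩ := hPD (m * r) (by omega)
      exact ⟨m * r, j, hj, by omega, by omega, hpj, Or.inl (by omega)⟩
  have hij : j ≤ i + 6 * L * D ∧ i ≤ j + 6 * L * D := by
    have e1 := h.dist_triangle (γ i) p (γ j)
    have e2 := h.dist_triangle p m (γ j)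
    have e3 := h.dist_triangle m q (γ j)
    rw [h.dist_comm (γ i) p] at e1
    have e4 : lenDist ℓ (γ i) (γ j) ≤ 6 * D := by omega
    have e5 : lenDist ℓ' (γ i) (γ j) ≤ L * (6 * D) := (hL' _).trans (Nat.mul_le_mul_left L e4)
    have e6 : L * (6 * D) = 6 * L * D := by ring
    rcases le_total i j with hle | hle
    · rw [h2 i j hle hj] at e5; omega
    · rw [h'.dist_comm, h2 j i hle hi] at e5; omega
  have hstep : ∀ a b, a ≤ N → b ≤ N → a ≤ b + 1 → b ≤ a + 1 →
      lenDist ℓ (γ a) (γ b) ≤ L := by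
    intro a b ha hb hab hba
    have e : lenDist ℓ' (γ a) (γ b) ≤ 1 := by
      rcases le_total a b with hle | hle
      · rw [h2 a b hle hb]; omega
      · rw [h'.dist_comm, h2 b a hle ha]; omega
    calc lenDist ℓ (γ a) (γ b) ≤ L * lenDist ℓ' (γ a) (γ b) := hL _
      _ ≤ L * 1 := Nat.mul_le_mul_left L e
      _ = L := mul_one L
  let σ : ℕ → ℕ := fun t => if i ≤ j then min (i + t) j else max (i - t) j
  have hσN : ∀ t, σ t ≤ N := fun t => by simp only [σ]; split_ifs <;> omega
  have hσ1 : ∀ t, σ t ≤ σ (t + 1) + 1 := fun t => by simp only [σ]; split_ifs <;> omega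
  have hσ2 : ∀ t, σ (t + 1) ≤ σ t + 1 := fun t => by simp only [σ]; split_ifs <;> omega
  have hσ0 : σ 0 = i := by simp only [σ]; split_ifs <;> omega
  have hσe : σ (2 ^ k - 2) = j := by simp only [σ]; split_ifs <;> omega
  let c : ℕ → Γ := fun t => if t = 0 then p else if t < 2 ^ k then γ (σ (t - 1)) else q
  have hc0 : c 0 = p := by simp [c]
  have hce : c (2 ^ k) = q := by simp [c]
  have hcm : ∀ t, 1 ≤ t → t < 2 ^ k → c t = γ (σ (t - 1)) := fun t h1 h2 => by
    simp [c, h2, show t ≠ 0 by omega]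
  have hB := h.chain_product hδ m (D - L) k c (by
    intro t ht
    rcases Nat.eq_zero_or_pos t with rfl | htpos
    · rw [zero_add, hc0, hcm 1 le_rfl (by omega)]
      simp only [Nat.sub_self, hσ0]
      have := hfar i hi
      rcases hp4 with hp4 | hp4
      · rw [h.dist_comm m p]; omega
      · rw [hp4, h.dist_self]; omega
    · rw [hcm t htpos ht]
      rcases Nat.lt_or_ge (t + 1) (2 ^ k) with ht' | ht'
      · rw [hcm (t + 1) (by omega) ht']
        have e1 := hfar _ (hσN (t - 1))
        have e2 := hfar _ (hσN t)
        have e3 := hσ1 (t - 1)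
        have e4 := hσ2 (t - 1)
        rw [Nat.sub_add_cancel htpos] at e3 e4
        have e5 := hstep _ _ (hσN (t - 1)) (hσN t) e3 e4
        simp only [Nat.add_sub_cancel]
        omega
      · obtain e : t + 1 = 2 ^ k := by omega
        rw [e, hce, show t - 1 = 2 ^ k - 2 by omega, hσe]
        have := hfar j hj
        rcases hq4 with hq4 | hq4
        · rw [h.dist_comm (γ j) q]; omega
        · rw [hq4, h.dist_self]; omega)
  rw [hc0, hce, h.dist_comm m p] at hB
  have e1 := h.dist_triangle 1 p z
  have e2 := h.dist_triangle p q z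
  simp only [dist_one_left] at e1
  have e3 : 2 * k * δ = 2 * (k * δ) := by ring
  omega

/-- Almost geodesic concatenations stay almost geodesic for a bi-Lipschitz equivalent length. -/
lemma quasi_additive {δ : ℕ} (hδ : FourPoint ℓ δ) {ℓ' : Γ → ℕ} (h' : IsLength ℓ')
    (L : ℕ) (hL : ∀ x, ℓ x ≤ L * ℓ' x) (hL' : ∀ x, ℓ' x ≤ L * ℓ x) (C : ℕ) :
    ∃ C', ∀ x y, ℓ x + ℓ y ≤ ℓ (x * y) + C → ℓ' x + ℓ' y ≤ ℓ' (x * y) + C' := by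
  obtain ⟨R, hR⟩ := h.exists_close_to_geodesic hδ h' L hL hL'
  refine ⟨2 * (L * (R + 2 * C + 2 * δ)), fun x y hxy => ?_⟩
  set z := x * y with hz
  obtain ⟨m, r, hmr, hm, hr⟩ := h.split z (min (ℓ x) (ℓ z)) (min_le_right _ _)
  have e1 : lenDist ℓ m z = ℓ r := by rw [← hmr, dist_mul_right]
  have e2 : lenDist ℓ x z = ℓ y := dist_mul_right x y
  obtain ⟨p, hp, hmp⟩ := hR z m (by omega)
  have e3 := h.near_geodesic hδ (a := x) (b := m) (z := z) (C := C) (by omega) (by omega)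
  have e4 : lenDist ℓ x p ≤ R + 2 * C + 2 * δ := by
    have := h.dist_triangle x m p
    omega
  have e5 : lenDist ℓ' x p ≤ L * (R + 2 * C + 2 * δ) := (hL' _).trans (Nat.mul_le_mul_left L e4)
  have e6 := h'.dist_triangle 1 p x
  have e7 := h'.dist_triangle x p z
  rw [h'.dist_comm p x] at e6
  simp only [dist_one_left] at e6
  have e8 : lenDist ℓ' x z = ℓ' y := dist_mul_right x y
  omega

end IsLength

/-- Volume growth rate of a proper length function. -/
noncomputable def lenGrowth (ℓ : Γ → ℕ) : ℝ :=
  limsup (fun n : ℕ => Real.log (Nat.card {x : Γ // ℓ x ≤ n}) / (n : ℝ)) atTop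

namespace IsLength

variable {ℓ : Γ → ℕ} (h : IsLength ℓ)

/-- The closed ball of radius `n` about the identity. -/
noncomputable def ball (n : ℕ) : Finset Γ := (h.fin n).toFinset

/-- The sphere of radius `n` about the identity. -/
noncomputable def sphere (n : ℕ) : Finset Γ := (h.ball n).filter fun x => ℓ x = n

include h

@[simp] lemma mem_ball {n : ℕ} {x : Γ} : x ∈ h.ball n ↔ ℓ x ≤ n := by simp [ball]

@[simp] lemma mem_sphere {n : ℕ} {x : Γ} : x ∈ h.sphere n ↔ ℓ x = n := by
  simp only [sphere, Finset.mem_filter, mem_ball]; omega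

lemma sphere_subset_ball (n : ℕ) : h.sphere n ⊆ h.ball n := Finset.filter_subset _ _

lemma card_ball_eq (n : ℕ) : Nat.card {x : Γ // ℓ x ≤ n} = (h.ball n).card := by
  rw [Nat.subtype_card]
  simp

lemma card_sphere_eq (n : ℕ) : Nat.card {x : Γ // ℓ x = n} = (h.sphere n).card := by
  rw [Nat.subtype_card]
  simp

lemma card_ball_pos (n : ℕ) : 0 < (h.ball n).card :=
  Finset.card_pos.2 ⟨1, by simp [h.one]⟩

lemma card_sphere_add_le (m n : ℕ) :
    (h.sphere (m + n)).card ≤ (h.sphere m).card * (h.sphere n).card := by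
  classical
  rw [← Finset.card_product]
  refine (Finset.card_le_card (t := (h.sphere m ×ˢ h.sphere n).image fun p => p.1 * p.2)
    fun x hx => ?_).trans Finset.card_image_le
  rw [mem_sphere] at hx
  obtain ⟨p, q, hpq, hp, hq⟩ := h.split x m (by omega)
  exact Finset.mem_image.2 ⟨(p, q), by simp only [Finset.mem_product, mem_sphere]; omega, hpq⟩

lemma card_sphere_mul_add_le (N k r : ℕ) :
    (h.sphere (k * N + r)).card ≤ (h.sphere N).card ^ k * (h.sphere r).card := by
  induction k with
  | zero => simp
  | succ k ih =>
    rw [show (k + 1) * N + r = N + (k * N + r) by ring, pow_succ', mul_assoc]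
    exact (h.card_sphere_add_le _ _).trans (Nat.mul_le_mul_left _ ih)

lemma card_ball_le_pow (n : ℕ) : (h.ball n).card ≤ (h.ball 1).card ^ n := by
  classical
  induction n with
  | zero =>
    refine (Finset.card_le_card (t := {1}) fun x hx => ?_).trans (by simp)
    rw [mem_ball] at hx
    simpa using h.eq_one x (by omega)
  | succ n ih =>
    have : (h.ball (n + 1)).card ≤ (h.ball n).card * (h.ball 1).card := by
      rw [← Finset.card_product]
      refine (Finset.card_le_card (t := (h.ball n ×ˢ h.ball 1).image fun p => p.1 * p.2)
        fun x hx => ?_).trans Finset.card_image_le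
      rw [mem_ball] at hx
      obtain ⟨p, q, hpq, hp, hq⟩ := h.split x (min n (ℓ x)) (by omega)
      exact Finset.mem_image.2
        ⟨(p, q), by simp only [Finset.mem_product, mem_ball]; omega, hpq⟩
    rw [pow_succ]
    exact this.trans (Nat.mul_le_mul_right _ ih)

/-- A length function dominates every subadditive length function up to a constant factor. -/
lemma exists_le_mul {f : Γ → ℝ} (hf0 : ∀ x, 0 ≤ f x) (hf1 : f 1 = 0)
    (hf : ∀ x y, f (x * y) ≤ f x + f y) : ∃ L : ℕ, ∀ x, f x ≤ L * ℓ x := by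
  obtain ⟨L, hL⟩ := exists_nat_ge (∑ x ∈ h.ball 1, f x)
  refine ⟨L, fun x => ?_⟩
  obtain ⟨n, hn⟩ : ∃ n, ℓ x = n := ⟨_, rfl⟩
  induction n generalizing x with
  | zero => rw [h.eq_one x hn, hf1]; positivity
  | succ n ih =>
    obtain ⟨p, q, hpq, hp, hq⟩ := h.split x n (by omega)
    have e1 := ih p hp
    have e2 : f q ≤ L := (Finset.single_le_sum (fun y _ => hf0 y)
      (show q ∈ h.ball 1 by rw [mem_ball]; omega)).trans hL
    have e3 := hf p q
    rw [hpq] at e3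
    rw [hp] at e1
    rw [hn]; push_cast
    linarith

/-- Summation over spheres. -/
lemma summable_of_sphere {f : Γ → ℝ} (hf : ∀ x, 0 ≤ f x) {g : ℕ → ℝ} (hg : Summable g)
    (hfg : ∀ n, ∑ x ∈ h.sphere n, f x ≤ g n) : Summable f := by
  classical
  have hg0 : ∀ n, 0 ≤ g n := fun n => (Finset.sum_nonneg fun x _ => hf x).trans (hfg n)
  refine summable_of_sum_le (c := ∑' n, g n) hf fun u => ?_
  calc ∑ x ∈ u, f x = ∑ n ∈ u.image ℓ, ∑ x ∈ u with ℓ x = n, f x :=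
        (Finset.sum_fiberwise_of_maps_to (fun x hx => Finset.mem_image_of_mem _ hx) _).symm
    _ ≤ ∑ n ∈ u.image ℓ, g n := by
        refine Finset.sum_le_sum fun n _ => le_trans ?_ (hfg n)
        refine Finset.sum_le_sum_of_subset_of_nonneg (fun x hx => ?_) fun x _ _ => hf x
        rw [mem_sphere]; exact (Finset.mem_filter.1 hx).2
    _ ≤ ∑' n, g n := hg.sum_le_tsum _ fun n _ => hg0 n

lemma summable_exp_of_card_sphere_le {A r s : ℝ} (hrs : r < s)
    (hA : ∀ n, ((h.sphere n).card : ℝ) ≤ A * Real.exp (r * n)) :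
    Summable fun x => Real.exp (-s * ℓ x) := by
  refine h.summable_of_sphere (fun x => (Real.exp_pos _).le)
    (g := fun n => A * Real.exp (r - s) ^ n)
    ((summable_geometric_of_lt_one (Real.exp_pos _).le
      (Real.exp_lt_one_iff.2 (by linarith))).mul_left A) fun n => ?_
  rw [Finset.sum_congr rfl (fun x hx => by rw [h.mem_sphere.1 hx]), Finset.sum_const,
    nsmul_eq_mul]
  calc _ ≤ A * Real.exp (r * n) * Real.exp (-s * n) :=
        mul_le_mul_of_nonneg_right (hA n) (Real.exp_pos _).le
    _ = _ := by rw [mul_assoc, ← Real.exp_add, ← Real.exp_nat_mul]; ring_nf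

lemma isBoundedUnder_growth : IsBoundedUnder (· ≤ ·) atTop
    (fun n : ℕ => Real.log (Nat.card {x : Γ // ℓ x ≤ n}) / (n : ℝ)) := by
  refine isBoundedUnder_of ⟨Real.log (h.ball 1).card, fun n => ?_⟩
  rw [h.card_ball_eq]
  rcases Nat.eq_zero_or_pos n with rfl | hn
  · simp only [Nat.cast_zero, div_zero]
    exact Real.log_natCast_nonneg _
  · rw [div_le_iff₀ (by exact_mod_cast hn), mul_comm, ← Real.log_pow]
    refine Real.log_le_log (by exact_mod_cast h.card_ball_pos n) ?_
    exact_mod_cast h.card_ball_le_pow n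

omit [Group Γ] h in
lemma isCoboundedUnder_growth : IsCoboundedUnder (· ≤ ·) atTop
    (fun n : ℕ => Real.log (Nat.card {x : Γ // ℓ x ≤ n}) / (n : ℝ)) :=
  IsBoundedUnder.isCoboundedUnder_le (isBoundedUnder_of
    ⟨0, fun n => div_nonneg (Real.log_natCast_nonneg _) n.cast_nonneg⟩)

lemma lenGrowth_nonneg : 0 ≤ lenGrowth ℓ :=
  le_limsup_of_frequently_le (Frequently.of_forall fun n =>
    div_nonneg (Real.log_natCast_nonneg _) n.cast_nonneg) h.isBoundedUnder_growth

lemma summable_of_lenGrowth_lt {s : ℝ} (hs : lenGrowth ℓ < s) :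
    Summable fun x => Real.exp (-s * ℓ x) := by
  obtain ⟨r, hr, hrs⟩ := exists_between hs
  have hr0 : 0 ≤ r := h.lenGrowth_nonneg.trans hr.le
  obtain ⟨n₀, hn₀⟩ := eventually_atTop.1
    (eventually_lt_of_limsup_lt hr h.isBoundedUnder_growth)
  refine h.summable_exp_of_card_sphere_le (A := (h.ball n₀).card) hrs fun n => ?_
  have hb : (1 : ℝ) ≤ (h.ball n₀).card := by exact_mod_cast h.card_ball_pos n₀
  have hexp : 1 ≤ Real.exp (r * n) := Real.one_le_exp (by positivity)
  rcases le_total n n₀ with hn | hn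
  · have : ((h.sphere n).card : ℝ) ≤ (h.ball n₀).card := by
      refine Nat.cast_le.2 (Finset.card_le_card fun x hx => ?_)
      rw [mem_sphere] at hx; rw [mem_ball]; omega
    nlinarith
  · rcases Nat.eq_zero_or_pos n with rfl | hpos
    · have : ((h.sphere 0).card : ℝ) ≤ (h.ball n₀).card := by
        refine Nat.cast_le.2 (Finset.card_le_card fun x hx => ?_)
        rw [mem_sphere] at hx; rw [mem_ball]; omega
      nlinarith
    have e := hn₀ n hn
    rw [h.card_ball_eq, div_lt_iff₀ (by exact_mod_cast hpos)] at e
    have e2 : ((h.ball n).card : ℝ) ≤ Real.exp (r * n) := by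
      rw [← Real.log_le_iff_le_exp (by exact_mod_cast h.card_ball_pos n)]
      exact e.le
    have e3 : ((h.sphere n).card : ℝ) ≤ (h.ball n).card :=
      Nat.cast_le.2 (Finset.card_le_card (h.sphere_subset_ball n))
    nlinarith

lemma lenGrowth_le_of_summable {s : ℝ} (hs0 : 0 ≤ s)
    (hs : Summable fun x => Real.exp (-s * ℓ x)) : lenGrowth ℓ ≤ s := by
  set M := ∑' x, Real.exp (-s * ℓ x) with hM
  have hb : ∀ n : ℕ, ((h.ball n).card : ℝ) ≤ M * Real.exp (s * n) := by
    intro n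
    have e : ((h.ball n).card : ℝ) * Real.exp (-s * n) ≤ M := by
      rw [← nsmul_eq_mul, ← Finset.sum_const]
      refine le_trans (Finset.sum_le_sum fun x hx => ?_)
        (hs.sum_le_tsum (h.ball n) fun x _ => (Real.exp_pos _).le)
      have : (ℓ x : ℝ) ≤ n := by exact_mod_cast h.mem_ball.1 hx
      exact Real.exp_le_exp.2 (by nlinarith)
    calc ((h.ball n).card : ℝ)
        = (h.ball n).card * Real.exp (-s * n) * Real.exp (s * n) := by
          rw [mul_assoc, ← Real.exp_add]; simp
      _ ≤ _ := mul_le_mul_of_nonneg_right e (Real.exp_pos _).le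
  have hMpos : 0 < M := by
    have := hb 0
    have h2 : (0 : ℝ) < (h.ball 0).card := by exact_mod_cast h.card_ball_pos 0
    simp only [Nat.cast_zero, mul_zero, Real.exp_zero, mul_one] at this
    linarith
  refine le_of_forall_pos_le_add fun ε hε => ?_
  refine limsup_le_of_le isCoboundedUnder_growth ?_
  have h1 : Tendsto (fun n : ℕ => Real.log M / (n : ℝ)) atTop (𝓝 0) :=
    tendsto_const_div_atTop_nhds_zero_nat _
  filter_upwards [h1.eventually (gt_mem_nhds hε), eventually_gt_atTop 0] with n hn hpos
  have hpos' : (0 : ℝ) < n := by exact_mod_cast hpos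
  rw [h.card_ball_eq]
  have e : Real.log (h.ball n).card ≤ Real.log M + s * n := by
    rw [← Real.log_exp (s * n), ← Real.log_mul hMpos.ne' (Real.exp_pos _).ne']
    exact Real.log_le_log (by exact_mod_cast h.card_ball_pos n) (hb n)
  rw [div_lt_iff₀ hpos'] at hn
  rw [div_le_iff₀ hpos']
  linarith

/-- Spheres have at least the expected exponential size. -/
lemma exp_le_card_sphere (hv : 0 < lenGrowth ℓ) (N : ℕ) :
    Real.exp (lenGrowth ℓ * N) ≤ (h.sphere N).card := by
  rcases Nat.eq_zero_or_pos N with rfl | hN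
  · have : 0 < (h.sphere 0).card := Finset.card_pos.2 ⟨1, by simp [h.one]⟩
    simpa using this
  have hN' : (0 : ℝ) < N := by exact_mod_cast hN
  by_contra! hlt
  obtain ⟨s, hs0, hsv, hs⟩ : ∃ s, 0 < s ∧ s < lenGrowth ℓ ∧
      ((h.sphere N).card : ℝ) ≤ Real.exp (s * N) := by
    rcases Nat.eq_zero_or_pos (h.sphere N).card with h0 | h0
    · exact ⟨lenGrowth ℓ / 2, by linarith, by linarith, by rw [h0]; simp [(Real.exp_pos _).le]⟩
    · have h0' : (0 : ℝ) < (h.sphere N).card := by exact_mod_cast h0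
      have e := (Real.log_lt_iff_lt_exp h0').2 hlt
      rw [← div_lt_iff₀ hN'] at e
      obtain ⟨s, hs1, hs2⟩ := exists_between (max_lt e hv)
      refine ⟨s, (le_max_right _ _).trans_lt hs1, hs2, ?_⟩
      have := (le_max_left _ _).trans hs1.le
      rw [div_le_iff₀ hN'] at this
      exact (Real.log_le_iff_le_exp h0').1 this
  obtain ⟨s', hs1, hs2⟩ := exists_between hsv
  refine hs2.not_ge (h.lenGrowth_le_of_summable (hs0.trans hs1).le
    (h.summable_exp_of_card_sphere_le (A := (h.ball N).card) hs1 fun n => ?_))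
  have e1 := h.card_sphere_mul_add_le N (n / N) (n % N)
  rw [Nat.div_add_mod'] at e1
  have e2 : (h.sphere (n % N)).card ≤ (h.ball N).card := Finset.card_le_card fun x hx => by
    rw [mem_sphere] at hx; rw [mem_ball]
    have := Nat.mod_lt n hN
    omega
  have e3 : ((h.sphere n).card : ℝ) ≤ (h.sphere N).card ^ (n / N) * (h.ball N).card := by
    exact_mod_cast e1.trans (Nat.mul_le_mul_left _ e2)
  have e4 : ((h.sphere N).card : ℝ) ^ (n / N) ≤ Real.exp (s * n) := by
    refine (pow_le_pow_left₀ (Nat.cast_nonneg _) hs _).trans ?_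
    rw [← Real.exp_nat_mul]
    refine Real.exp_le_exp.2 ?_
    have : ((n / N : ℕ) : ℝ) * N ≤ n := by exact_mod_cast Nat.div_mul_le_self n N
    nlinarith
  rw [mul_comm]
  exact e3.trans (mul_le_mul_of_nonneg_right e4 (Nat.cast_nonneg _))

end IsLength

lemma exists_eventually_eq_of_finite {α β : Type*} (𝒰 : Ultrafilter α) {f : α → β} {F : Set β}
    (hF : F.Finite) (hf : ∀ᶠ a in 𝒰, f a ∈ F) : ∃ c ∈ F, ∀ᶠ a in 𝒰, f a = c := by
  obtain ⟨c, hc, h⟩ := Ultrafilter.eq_pure_of_finite_mem (f := 𝒰.map f) hF hf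
  refine ⟨c, hc, ?_⟩
  have : {c} ∈ 𝒰.map f := by rw [h]; simp
  exact this

namespace IsLength

variable {ℓ : Γ → ℕ} (h : IsLength ℓ)

/-- Two translates of a sequence of points fellow travel along an ultrafilter. -/
def Fellow (ℓ : Γ → ℕ) (𝒰 : Ultrafilter ℕ) (y : ℕ → Γ) (g g' : Γ) : Prop :=
  ∀ M : ℕ, ∀ᶠ R in 𝒰, 2 * M + lenDist ℓ (g * y R) (g' * y R) ≤ ℓ (g * y R) + ℓ (g' * y R)

include h

omit h in
lemma Fellow.symm {𝒰 : Ultrafilter ℕ} {y : ℕ → Γ} (h : IsLength ℓ) {g g' : Γ}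
    (hg : Fellow ℓ 𝒰 y g g') : Fellow ℓ 𝒰 y g' g := fun M =>
  (hg M).mono fun R hR => by rw [h.dist_comm]; omega

omit h in
lemma Fellow.trans {𝒰 : Ultrafilter ℕ} {y : ℕ → Γ} (h : IsLength ℓ) {δ : ℕ}
    (hδ : FourPoint ℓ δ) {g g' g'' : Γ}
    (hg : Fellow ℓ 𝒰 y g g') (hg' : Fellow ℓ 𝒰 y g' g'') : Fellow ℓ 𝒰 y g g'' := fun M => by
  filter_upwards [hg (M + δ), hg' (M + δ)] with R h1 h2
  have h3 := hδ (g * y R) (g'' * y R) 1 (g' * y R)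
  rw [h.dist_comm (g * y R) 1, h.dist_comm (g'' * y R) 1, h.dist_comm (g'' * y R)] at h3
  simp only [dist_one_left] at h3
  omega

omit h in
lemma Fellow.mul_left {𝒰 : Ultrafilter ℕ} {y : ℕ → Γ} (h : IsLength ℓ) {g g' : Γ}
    (hg : Fellow ℓ 𝒰 y g g') (a : Γ) : Fellow ℓ 𝒰 y (a * g) (a * g') := fun M => by
  filter_upwards [hg (M + ℓ a)] with R h1
  have h2 := h.mul a⁻¹ (a * g * y R)
  have h3 := h.mul a⁻¹ (a * g' * y R)
  have e1 : a⁻¹ * (a * g * y R) = g * y R := by group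
  have e2 : a⁻¹ * (a * g' * y R) = g' * y R := by group
  rw [h.inv, e1] at h2
  rw [h.inv, e2] at h3
  rw [mul_assoc a g, mul_assoc a g', dist_left, ← mul_assoc, ← mul_assoc]
  omega

/-- Conjugation by a far away point of a geodesic makes a fellow travelling element short. -/
lemma length_conj_le {δ : ℕ} (hδ : FourPoint ℓ δ) {g y w : Γ} {T : ℕ}
    (hw : ℓ w + lenDist ℓ w y = ℓ y) (hw1 : ℓ g + δ < ℓ w)
    (hgy : 2 * (ℓ w + ℓ g + δ + 1) + lenDist ℓ y (g * y) ≤ ℓ y + ℓ (g * y))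
    (h1 : ℓ (g * y) ≤ ℓ y + T) (h2 : ℓ y ≤ ℓ (g * y) + T) :
    ℓ (w⁻¹ * g * w) ≤ T + 8 * δ := by
  have e0 : lenDist ℓ w (g * w) = ℓ (w⁻¹ * g * w) := by rw [lenDist, mul_assoc]
  rw [← e0]
  have e1 : lenDist ℓ (g * w) (g * y) = lenDist ℓ w y := dist_left _ _ _
  have a1 := hδ (g * w) y 1 (g * y)
  have a2 := hδ (g * w) 1 g (g * y)
  have t1 := h.mul g⁻¹ (g * w)
  have t2 := h.mul g w
  have t3 := h.mul g y
  have t4 := h.dist_triangle 1 (g * w) (g * y)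
  have t5 := h.dist_triangle w (g * w) y
  have t6 := h.mul w (w⁻¹ * g * w)
  have t7 := h.dist_triangle 1 (g * w) y
  rw [h.inv, inv_mul_cancel_left] at t1
  have b1 : lenDist ℓ g (g * y) = ℓ y := dist_mul_right _ _
  have b2 : lenDist ℓ (g * w) g = ℓ w := by rw [h.dist_comm, dist_mul_right]
  rw [h.dist_comm (g * w) 1] at a1 a2
  rw [h.dist_comm y 1] at a1
  simp only [dist_one_left] at a1 a2 t4 t7
  have n1 : ℓ (g * w) + ℓ y ≤ ℓ (g * y) + ℓ w + 2 * δ := by omega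
  have n2 : ℓ (g * w) + lenDist ℓ (g * w) y ≤ ℓ y + 4 * δ := by omega
  have n3 := h.near_geodesic hδ (a := w) (b := g * w) (z := y) (C := 4 * δ) (by omega) n2
  omega

/-- A group whose large balls, translated by some points, see boundedly many directions is
virtually cyclic. -/
theorem virtually_cyclic_of_directions {δ k : ℕ} (hδ : FourPoint ℓ δ)
    (hk : ∀ R : ℕ, ∃ (y : Γ) (χ : Γ → Γ) (A : Finset Γ), A.card ≤ k ∧
      (∀ u, ℓ u ≤ R → χ u ∈ A) ∧ ∀ u v, ℓ u ≤ R → ℓ v ≤ R → χ u = χ v →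
        2 * R + lenDist ℓ (u * y) (v * y) ≤ ℓ (u * y) + ℓ (v * y)) :
    ∃ H : Subgroup Γ, H.FiniteIndex ∧ ∃ g : Γ, H = Subgroup.zpowers g := by
  classical
  choose y χ A hA hχ hy using hk
  let 𝒰 : Ultrafilter ℕ := hyperfilter ℕ
  have hlarge : ∀ n : ℕ, ∀ᶠ R in (𝒰 : Filter ℕ), n ≤ R := fun n =>
    Filter.Eventually.filter_mono (Nat.hyperfilter_le_atTop) (eventually_ge_atTop n)
  have hone : Fellow ℓ 𝒰 y 1 1 := fun M => (hlarge M).mono fun R hR => by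
    have := hy R 1 1 (by simp [h.one]) (by simp [h.one]) rfl
    omega
  have hyR : ∀ R, R ≤ ℓ (y R) := fun R => by
    have := hy R 1 1 (by simp [h.one]) (by simp [h.one]) rfl
    rw [h.dist_self, one_mul] at this
    omega
  let H : Subgroup Γ :=
    { carrier := {g | Fellow ℓ 𝒰 y 1 g}
      one_mem' := hone
      mul_mem' := fun {a b} ha hb => by
        have := Fellow.mul_left h hb a
        rw [mul_one] at this
        exact Fellow.trans h hδ ha this
      inv_mem' := fun {a} ha => by
        have := Fellow.mul_left h ha a⁻¹
        rw [mul_one, inv_mul_cancel] at this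
        exact this.symm h }
  have hHmem : ∀ g, g ∈ H ↔ Fellow ℓ 𝒰 y 1 g := fun g => Iff.rfl
  have hfin : Finite (Γ ⧸ H) := by
    by_contra hinf
    rw [not_finite_iff_infinite] at hinf
    let t : Fin (k + 1) → Γ := fun i => (Infinite.natEmbedding (Γ ⧸ H) i).out
    have hev : ∀ᶠ R in (𝒰 : Filter ℕ), ∃ p : Fin (k + 1) × Fin (k + 1),
        p.1 ≠ p.2 ∧ χ R (t p.1) = χ R (t p.2) := by
      refine (hlarge (∑ i, ℓ (t i))).mono fun R hR => ?_
      obtain ⟨i, -, j, -, hij, he⟩ := Finset.exists_ne_map_eq_of_card_lt_of_maps_to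
        (s := (Finset.univ : Finset (Fin (k + 1)))) (t := A R) (f := fun i => χ R (t i))
        (by rw [Finset.card_fin]; exact Nat.lt_succ_of_le (hA R))
        (fun i _ => hχ R _ ((Finset.single_le_sum (f := fun i => ℓ (t i))
          (fun _ _ => Nat.zero_le _) (Finset.mem_univ i)).trans hR))
      exact ⟨(i, j), hij, he⟩
    have hpair : ∃ p : Fin (k + 1) × Fin (k + 1),
        ∀ᶠ R in (𝒰 : Filter ℕ), p.1 ≠ p.2 ∧ χ R (t p.1) = χ R (t p.2) := by
      by_contra! hno
      have := eventually_all.2 hno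
      obtain ⟨R, hR1, p, hR2⟩ := (this.and hev).exists
      exact hR1 p hR2.1 hR2.2
    obtain ⟨⟨i, j⟩, hp⟩ := hpair
    have hne : i ≠ j := hp.exists.choose_spec.1
    have hf : Fellow ℓ 𝒰 y (t i) (t j) := fun M => by
      filter_upwards [hp, hlarge M, hlarge (ℓ (t i)), hlarge (ℓ (t j))] with R h1 h2 h3 h4
      have := hy R _ _ h3 h4 h1.2
      omega
    have hmem : (t i)⁻¹ * t j ∈ H := by
      have := Fellow.mul_left h hf (t i)⁻¹
      rwa [inv_mul_cancel] at this
    have hq : (QuotientGroup.mk (t i) : Γ ⧸ H) = QuotientGroup.mk (t j) :=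
      QuotientGroup.eq.2 hmem
    simp only [t, QuotientGroup.out_eq', EmbeddingLike.apply_eq_iff_eq] at hq
    exact hne (Fin.ext hq)
  have hs : ∀ g, ∃ c : ℤ, ∀ᶠ R in (𝒰 : Filter ℕ), (ℓ (y R) : ℤ) - lenDist ℓ g (y R) = c := by
    intro g
    obtain ⟨c, -, hc⟩ := exists_eventually_eq_of_finite 𝒰
      (Set.finite_Icc (-(ℓ g : ℤ)) (ℓ g))
      (f := fun R => (ℓ (y R) : ℤ) - lenDist ℓ g (y R)) (Eventually.of_forall fun R => by
        have h1 := h.dist_triangle 1 g (y R)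
        have h2 := h.dist_triangle g 1 (y R)
        rw [h.dist_comm g 1] at h2
        simp only [dist_one_left] at h1 h2
        rw [Set.mem_Icc]
        omega)
    exact ⟨c, hc⟩
  choose s hs using hs
  have hquasi : ∀ g ∈ H, ∀ v, |s (g * v) - s g - s v| ≤ 2 * δ := by
    intro g hg v
    have hg' : Fellow ℓ 𝒰 y 1 g⁻¹ := H.inv_mem hg
    obtain ⟨R, h1, h2, h3, h4⟩ :=
      ((hs (g * v)).and ((hs g).and ((hs v).and (hg' (ℓ v + δ + 1))))).exists
    rw [one_mul] at h4
    rw [← h1, ← h2, ← h3]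
    have e1 : lenDist ℓ (g * v) (y R) = lenDist ℓ v (g⁻¹ * y R) := by
      rw [← dist_left g⁻¹, inv_mul_cancel_left]
    have e2 : lenDist ℓ g (y R) = ℓ (g⁻¹ * y R) := rfl
    rw [e1, e2]
    have a1 := hδ v (y R) 1 (g⁻¹ * y R)
    have a2 := hδ v (g⁻¹ * y R) 1 (y R)
    have t1 := h.dist_triangle 1 v (y R)
    have t2 := h.dist_triangle 1 v (g⁻¹ * y R)
    rw [h.dist_comm v 1, h.dist_comm (y R) 1] at a1
    rw [h.dist_comm v 1, h.dist_comm (g⁻¹ * y R) 1, h.dist_comm (g⁻¹ * y R) (y R)] at a2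
    simp only [dist_one_left] at a1 a2 t1 t2
    rw [abs_le]
    omega
  have hsfin : ∀ T : ℕ, {g | g ∈ H ∧ |s g| ≤ T}.Finite := by
    intro T
    have hfin' : {g | g ∈ H ∧ |s g⁻¹| ≤ T}.Finite := by
      by_contra hinf
      obtain ⟨F, hFs, hFc⟩ := Set.Infinite.exists_subset_card_eq hinf
        ((h.ball (T + 8 * δ)).card + 1)
      set t := ∑ g ∈ F, ℓ g + δ + 1 with ht
      have hsingle : ∀ g ∈ F, ℓ g ≤ ∑ g ∈ F, ℓ g := fun g hg =>
        Finset.single_le_sum (f := ℓ) (fun _ _ => Nat.zero_le _) hg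
      have hall : ∀ᶠ R in (𝒰 : Filter ℕ), ∀ g ∈ F,
          (ℓ (y R) : ℤ) - lenDist ℓ g⁻¹ (y R) = s g⁻¹ ∧
          2 * (t + ℓ g + δ + 1) + lenDist ℓ (1 * y R) (g * y R)
            ≤ ℓ (1 * y R) + ℓ (g * y R) :=
        (Filter.eventually_all_finset F).2 fun g hg =>
          (hs g⁻¹).and ((hFs hg).1 (t + ℓ g + δ + 1))
      obtain ⟨R, hR1, hR2⟩ := (hall.and (hlarge t)).exists
      obtain ⟨w, q, hwq, hw, hq⟩ := h.split (y R) t (hR2.trans (hyR R))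
      have hwd : lenDist ℓ w (y R) = ℓ q := by rw [← hwq, dist_mul_right]
      have hmaps : ∀ g ∈ F, w⁻¹ * g * w ∈ h.ball (T + 8 * δ) := by
        intro g hg
        obtain ⟨h1, h2⟩ := hR1 g hg
        have h3 := (hFs hg).2
        rw [one_mul] at h2
        have e : lenDist ℓ g⁻¹ (y R) = ℓ (g * y R) := by simp [lenDist]
        rw [← h1, e, abs_le] at h3
        rw [h.mem_ball]
        have := hsingle g hg
        exact h.length_conj_le hδ (y := y R) (by omega) (by omega) (by omega) (by omega)
          (by omega)
      have := Finset.card_le_card_of_injOn _ hmaps fun a _ b _ hab => by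
        simpa using hab
      omega
    refine (hfin'.image fun g => g⁻¹).subset fun g hg => ⟨g⁻¹, ?_, inv_inv g⟩
    exact ⟨H.inv_mem hg.1, by rw [inv_inv]; exact hg.2⟩
  have hcover : ∃ g, ∃ T : ℕ, ∀ v ∈ H, ∃ n : ℤ, g ^ n * v ∈ H ∧ |s (g ^ n * v)| ≤ T := by
    by_cases hsmall : ∀ v ∈ H, |s v| ≤ 2 * δ
    · exact ⟨1, 2 * δ, fun v hv => ⟨0, by simpa using hv, by simpa using hsmall v hv⟩⟩
    push Not at hsmall
    obtain ⟨g, hg, hgs⟩ := hsmall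
    refine ⟨g, (s g).natAbs, fun v hv => ?_⟩
    obtain ⟨n, hn⟩ : ∃ n, (s v).natAbs = n := ⟨_, rfl⟩
    induction n using Nat.strong_induction_on generalizing v with
    | _ n ih =>
      by_cases hle : (s v).natAbs ≤ (s g).natAbs
      · exact ⟨0, by simpa using hv, by
          rw [zpow_zero, one_mul, Int.abs_eq_natAbs]
          exact_mod_cast hle⟩
      have q1 := hquasi g hg v
      have q2 := hquasi g hg (g⁻¹ * v)
      rw [mul_inv_cancel_left] at q2
      rw [abs_le] at q1 q2
      rw [lt_abs] at hgs
      have : (s (g * v)).natAbs < n ∨ (s (g⁻¹ * v)).natAbs < n := by omega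
      rcases this with hlt | hlt
      · obtain ⟨m, hm1, hm2⟩ := ih _ hlt (g * v) (H.mul_mem hg hv) rfl
        rw [← mul_assoc, ← zpow_add_one] at hm1 hm2
        exact ⟨m + 1, hm1, hm2⟩
      · obtain ⟨m, hm1, hm2⟩ := ih _ hlt (g⁻¹ * v) (H.mul_mem (H.inv_mem hg) hv) rfl
        rw [← mul_assoc, ← zpow_sub_one] at hm1 hm2
        exact ⟨m - 1, hm1, hm2⟩
  obtain ⟨g, T, hT⟩ := hcover
  have := (hsfin T).to_subtype
  refine ⟨Subgroup.zpowers g, ?_, g, rfl⟩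
  have : Finite (Γ ⧸ Subgroup.zpowers g) := by
    refine Finite.of_surjective (α := (Γ ⧸ H) × {g | g ∈ H ∧ |s g| ≤ T})
      (fun p => QuotientGroup.mk (p.1.out * (p.2 : Γ)⁻¹)) fun q => ?_
    obtain ⟨x, rfl⟩ := QuotientGroup.mk_surjective q
    obtain ⟨b, hb⟩ := QuotientGroup.mk_out_eq_mul H x
    obtain ⟨n, hn1, hn2⟩ := hT b b.2
    refine ⟨(QuotientGroup.mk x, ⟨_, hn1, hn2⟩), ?_⟩
    rw [QuotientGroup.eq]
    simp only [hb]
    refine Subgroup.mem_zpowers_iff.2 ⟨n, ?_⟩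
    group
  exact Subgroup.finiteIndex_of_finite_quotient

end IsLength

/-- A sum along a map with bounded fibers is controlled by the sum over the image. -/
lemma sum_comp_le_of_card_fiber_le {α β : Type*} [DecidableEq β] {P : Finset α} {φ : α → β}
    {G : β → ℝ} (hG : ∀ z, 0 ≤ G z) {K : ℕ}
    (hK : ∀ z, (P.filter fun p => φ p = z).card ≤ K) :
    ∑ p ∈ P, G (φ p) ≤ K * ∑ z ∈ P.image φ, G z := by
  rw [Finset.sum_comp, Finset.mul_sum]
  refine Finset.sum_le_sum fun z _ => ?_
  rw [nsmul_eq_mul]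
  exact mul_le_mul_of_nonneg_right (Nat.cast_le.2 (hK z)) (hG z)

/-- A hyperbolic length function together with a choice of short connecting elements that make
products almost geodesic. -/
structure Connecting (ℓ : Γ → ℕ) (δ D : ℕ) (u : Γ → Γ → Γ) : Prop where
  len : IsLength ℓ
  hyp : FourPoint ℓ δ
  short : ∀ x y, ℓ (u x y) ≤ D
  long : ∀ x y, ℓ x + ℓ y ≤ ℓ (x * u x y * y) + D

lemma IsLength.exists_connecting {ℓ : Γ → ℕ} (h : IsLength ℓ) {δ : ℕ} (hδ : FourPoint ℓ δ)
    (hΓ : ¬ ∃ H : Subgroup Γ, H.FiniteIndex ∧ ∃ g : Γ, H = Subgroup.zpowers g) :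
    ∃ D u, Connecting ℓ δ D u := by
  classical
  obtain ⟨R, hR⟩ : ∃ R : ℕ, ∀ x y, ∃ u, ℓ u ≤ R ∧
      ℓ x + ℓ (u * y) ≤ ℓ (x * (u * y)) + 2 * R := by
    by_contra! hcon
    refine hΓ (h.virtually_cyclic_of_directions (k := 1) hδ fun R => ?_)
    obtain ⟨x, y, hxy⟩ := hcon (R + δ)
    refine ⟨y, fun _ => 1, {1}, by simp, by simp, fun u v hu hv _ => ?_⟩
    have h1 := hxy u (by omega)
    have h2 := hxy v (by omega)
    have e : ∀ z, lenDist ℓ z x⁻¹ = ℓ (x * z) := fun z => by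
      rw [h.dist_comm]; simp [lenDist]
    have h3 := hδ (u * y) (v * y) 1 x⁻¹
    rw [e, e, h.dist_comm (u * y) 1, h.dist_comm (v * y) 1] at h3
    simp only [IsLength.dist_one_left, mul_one, e] at h3
    omega
  choose u hu1 hu2 using hR
  refine ⟨3 * R, u, h, hδ, fun x y => (hu1 x y).trans (by omega), fun x y => ?_⟩
  have h1 := hu2 x y
  have h2 := hu1 x y
  have h3 := h.mul (u x y)⁻¹ (u x y * y)
  rw [inv_mul_cancel_left, h.inv] at h3
  rw [mul_assoc]
  omega

lemma IsLength.card_sphere_unbounded {ℓ : Γ → ℕ} (h : IsLength ℓ) {δ : ℕ} (hδ : FourPoint ℓ δ)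
    (hΓ : ¬ ∃ H : Subgroup Γ, H.FiniteIndex ∧ ∃ g : Γ, H = Subgroup.zpowers g) (K : ℕ) :
    ∃ n, K < (h.sphere n).card := by
  classical
  by_contra! hK
  have hinf : Infinite Γ := by
    by_contra hfin
    rw [not_infinite_iff_finite] at hfin
    exact hΓ ⟨Subgroup.zpowers 1, inferInstance, 1, rfl⟩
  refine hΓ (h.virtually_cyclic_of_directions (k := K) hδ fun R => ?_)
  obtain ⟨y, hy⟩ := Infinite.exists_notMem_finset (h.ball (2 * R))
  rw [h.mem_ball, not_le] at hy
  have hp : ∀ u, ∃ p, ℓ u ≤ R → ℓ p = R ∧ R + lenDist ℓ p (u * y) = ℓ (u * y) := by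
    intro u
    by_cases hu : ℓ u ≤ R
    · have h1 := h.mul u⁻¹ (u * y)
      rw [inv_mul_cancel_left, h.inv] at h1
      obtain ⟨p, q, hpq, h2, h3⟩ := h.split (u * y) R (by omega)
      refine ⟨p, fun _ => ⟨h2, ?_⟩⟩
      rw [← hpq, IsLength.dist_mul_right, hpq, h3]
    · exact ⟨1, fun hu' => absurd hu' hu⟩
  choose χ hχ using hp
  refine ⟨y, χ, h.sphere R, hK R, fun u hu => h.mem_sphere.2 (hχ u hu).1,
    fun u v hu hv huv => ?_⟩
  have h1 := (hχ u hu).2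
  have h2 := (hχ v hv).2
  have h3 := h.dist_triangle (u * y) (χ u) (v * y)
  rw [h.dist_comm (u * y) (χ u)] at h3
  rw [← huv] at h2
  omega

lemma IsLength.exists_bound_on_ball {ℓ : Γ → ℕ} (h : IsLength ℓ) {f : Γ → ℝ}
    (hf : ∀ x, 0 ≤ f x) (n : ℕ) : ∃ C, 0 ≤ C ∧ ∀ x, ℓ x ≤ n → f x ≤ C :=
  ⟨∑ x ∈ h.ball n, f x, Finset.sum_nonneg fun x _ => hf x, fun _ hx =>
    Finset.single_le_sum (fun y _ => hf y) (h.mem_ball.2 hx)⟩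

namespace Connecting

variable {ℓ : Γ → ℕ} {δ D : ℕ} {u : Γ → Γ → Γ} (hc : Connecting ℓ δ D u)
include hc

lemma exists_card_fiber_le : ∃ K : ℕ, ∀ (n : ℕ) (F : Finset Γ) (z : Γ) [DecidableEq Γ],
    ((hc.len.sphere n ×ˢ F).filter fun p => p.1 * u p.1 p.2 * p.2 = z).card ≤ K := by
  have h := hc.len
  refine ⟨(h.ball (2 * D + 2 * δ)).card * (h.ball D).card, fun n F z _ => ?_⟩
  rw [← Finset.card_product]
  rcases ((h.sphere n ×ˢ F).filter fun p => p.1 * u p.1 p.2 * p.2 = z).eq_empty_or_nonempty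
    with he | ⟨⟨x₀, y₀⟩, h0⟩
  · rw [he]; simp
  have key : ∀ x y, ℓ x = n → x * u x y * y = z → ℓ x + lenDist ℓ x z ≤ ℓ z + 2 * D := by
    rintro x y - rfl
    rw [mul_assoc, IsLength.dist_mul_right, ← mul_assoc]
    have h1 := hc.short x y
    have h2 := hc.long x y
    have h3 := h.mul (u x y) y
    omega
  simp only [Finset.mem_filter, Finset.mem_product, h.mem_sphere] at h0
  refine Finset.card_le_card_of_injOn (fun p => (x₀⁻¹ * p.1, u p.1 p.2)) ?_ ?_
  · rintro ⟨x, y⟩ hxy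
    simp only [Finset.coe_filter, Set.mem_ofPred_eq, Finset.mem_product, h.mem_sphere] at hxy
    simp only [Finset.coe_product, Set.mem_prod, Finset.mem_coe, h.mem_ball]
    have h1 := h.near_geodesic hc.hyp (key x₀ y₀ h0.1.1 h0.2) (key x y hxy.1.1 hxy.2)
    have h2 : lenDist ℓ x₀ x = ℓ (x₀⁻¹ * x) := rfl
    exact ⟨by omega, hc.short x y⟩
  · rintro ⟨x, y⟩ hxy ⟨x', y'⟩ hxy' he
    simp only [Finset.coe_filter, Set.mem_ofPred_eq] at hxy hxy'
    simp only [Prod.mk.injEq, mul_right_inj] at he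
    obtain ⟨rfl, he2⟩ := he
    have := hxy.2.trans hxy'.2.symm
    rw [he2] at this
    simpa using this

/-- Exponential sums over spheres are bounded in terms of the Poincaré series. -/
lemma exists_sum_sphere_le {f : Γ → ℝ} (hf : ∀ x, 0 ≤ f x)
    (hsub : ∀ x y, f (x * y) ≤ f x + f y) : ∃ K C : ℝ, ∀ s, 0 ≤ s →
      Summable (fun x => Real.exp (-s * f x)) → ∀ n,
      ∑ x ∈ hc.len.sphere n, Real.exp (-s * f x) ≤ K * Real.exp (s * C) := by
  classical
  obtain ⟨K, hK⟩ := hc.exists_card_fiber_le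
  obtain ⟨C, hC0, hC⟩ := hc.len.exists_bound_on_ball hf D
  refine ⟨K, C, fun s hs hsum n => ?_⟩
  set T := ∑' x, Real.exp (-s * f x) with hT
  have hTpos : 0 < T := hsum.tsum_pos (fun x => (Real.exp_pos _).le) 1 (Real.exp_pos _)
  set a := ∑ x ∈ hc.len.sphere n, Real.exp (-s * f x) with ha
  have key : ∀ F : Finset Γ, ∑ y ∈ F, a * Real.exp (-s * f y) ≤ K * Real.exp (s * C) * T := by
    intro F
    have h1 := sum_comp_le_of_card_fiber_le (P := hc.len.sphere n ×ˢ F)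
      (φ := fun p => p.1 * u p.1 p.2 * p.2) (G := fun z => Real.exp (-s * f z))
      (fun z => (Real.exp_pos _).le) (fun z => hK n F z)
    have h2 := hsum.sum_le_tsum ((hc.len.sphere n ×ˢ F).image fun p => p.1 * u p.1 p.2 * p.2)
      fun x _ => (Real.exp_pos _).le
    have h3 : ∑ y ∈ F, a * Real.exp (-s * f y) ≤ Real.exp (s * C) *
        ∑ p ∈ hc.len.sphere n ×ˢ F, Real.exp (-s * f (p.1 * u p.1 p.2 * p.2)) := by
      rw [← Finset.mul_sum, ha, Finset.sum_mul_sum, ← Finset.sum_product', Finset.mul_sum]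
      refine Finset.sum_le_sum fun p _ => ?_
      rw [← Real.exp_add, ← Real.exp_add]
      refine Real.exp_le_exp.2 ?_
      have e1 := hsub (p.1 * u p.1 p.2) p.2
      have e2 := hsub p.1 (u p.1 p.2)
      have e3 := hC _ (hc.short p.1 p.2)
      nlinarith
    calc _ ≤ _ := h3
      _ ≤ Real.exp (s * C) * (K * T) := mul_le_mul_of_nonneg_left
          (h1.trans (mul_le_mul_of_nonneg_left h2 (Nat.cast_nonneg K))) (Real.exp_pos _).le
      _ = _ := by ring
  have h4 : a * T ≤ K * Real.exp (s * C) * T := by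
    rw [hT, ← tsum_mul_left]
    exact Real.tsum_le_of_sum_le (fun y => mul_nonneg
      (Finset.sum_nonneg fun x _ => (Real.exp_pos _).le) (Real.exp_pos _).le) key
  exact le_of_mul_le_mul_right h4 hTpos

/-- Exponential sums over spheres stay bounded at the critical exponent. -/
lemma exists_sum_sphere_lenGrowth_le {ℓ' : Γ → ℕ} (h' : IsLength ℓ') :
    ∃ K : ℝ, ∀ n, ∑ x ∈ hc.len.sphere n, Real.exp (-(lenGrowth ℓ' * ℓ' x)) ≤ K := by
  obtain ⟨K, C, hKC⟩ := hc.exists_sum_sphere_le (f := fun x => (ℓ' x : ℝ))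
    (fun x => Nat.cast_nonneg _) (fun x y => by exact_mod_cast h'.mul x y)
  refine ⟨K * Real.exp (lenGrowth ℓ' * C), fun n => ?_⟩
  set v := lenGrowth ℓ'
  have h1 : Tendsto (fun s : ℝ => ∑ x ∈ hc.len.sphere n, Real.exp (-s * ℓ' x)) (𝓝[>] v)
      (𝓝 (∑ x ∈ hc.len.sphere n, Real.exp (-v * ℓ' x))) :=
    (Continuous.tendsto (by fun_prop) v).mono_left nhdsWithin_le_nhds
  have h2 : Tendsto (fun s : ℝ => K * Real.exp (s * C)) (𝓝[>] v) (𝓝 (K * Real.exp (v * C))) :=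
    (Continuous.tendsto (by fun_prop) v).mono_left nhdsWithin_le_nhds
  simp only [← neg_mul]
  refine le_of_tendsto_of_tendsto h1 h2 ?_
  filter_upwards [self_mem_nhdsWithin] with s hs
  exact hKC s (h'.lenGrowth_nonneg.trans (le_of_lt hs)) (h'.summable_of_lenGrowth_lt hs) n

lemma lenGrowth_pos {ℓ' : Γ → ℕ} (h' : IsLength ℓ')
    (hΓ : ¬ ∃ H : Subgroup Γ, H.FiniteIndex ∧ ∃ g : Γ, H = Subgroup.zpowers g) :
    0 < lenGrowth ℓ' := by
  by_contra! hle
  have h0 : lenGrowth ℓ' = 0 := le_antisymm hle h'.lenGrowth_nonneg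
  obtain ⟨K, hK⟩ := hc.exists_sum_sphere_lenGrowth_le h'
  obtain ⟨K', hK'⟩ := exists_nat_ge K
  obtain ⟨n, hn⟩ := hc.len.card_sphere_unbounded hc.hyp hΓ K'
  have := hK n
  rw [h0] at this
  simp only [zero_mul, neg_zero, Real.exp_zero, Finset.sum_const, nsmul_eq_mul, mul_one] at this
  have h2 : ((hc.len.sphere n).card : ℝ) ≤ K' := this.trans hK'
  exact hn.not_ge (by exact_mod_cast h2)

end Connecting

/-- A subadditive weight, additive up to bounded error along almost geodesics, whose
exponential sums over spheres are bounded. -/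
structure GoodWeight (ℓ : Γ → ℕ) (f : Γ → ℝ) : Prop where
  nonneg : ∀ x, 0 ≤ f x
  sub : ∀ x y, f (x * y) ≤ f x + f y
  quasi : ∀ C : ℕ, ∃ C' : ℝ, ∀ x y, ℓ x + ℓ y ≤ ℓ (x * y) + C → f x + f y ≤ f (x * y) + C'
  bdd : ∃ K : ℝ, ∀ (n : ℕ) (F : Finset Γ), (∀ x ∈ F, ℓ x = n) →
    ∑ x ∈ F, Real.exp (-f x) ≤ K

/-- An almost geodesic from `1` to `x` passes along a translate of `b`. -/
def Contains (ℓ : Γ → ℕ) (D : ℕ) (b x : Γ) : Prop :=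
  ∃ p q, x = p * b * q ∧ ℓ p + ℓ b + ℓ q ≤ ℓ x + D

lemma IsLength.exists_split_fun {ℓ : Γ → ℕ} (h : IsLength ℓ) : ∃ p q : Γ → ℕ → Γ,
    ∀ x i, i ≤ ℓ x → p x i * q x i = x ∧ ℓ (p x i) = i ∧ i + ℓ (q x i) = ℓ x := by
  have : ∀ x i, ∃ p q, i ≤ ℓ x → p * q = x ∧ ℓ p = i ∧ i + ℓ q = ℓ x := fun x i => by
    by_cases hi : i ≤ ℓ x
    · obtain ⟨p, q, hpq⟩ := h.split x i hi
      exact ⟨p, q, fun _ => hpq⟩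
    · exact ⟨1, 1, fun hi' => absurd hi' hi⟩
  choose p q hpq using this
  exact ⟨p, q, hpq⟩

namespace Connecting

variable {ℓ : Γ → ℕ} {δ D : ℕ} {u : Γ → Γ → Γ} (hc : Connecting ℓ δ D u)
include hc

/-- Inserting `b` at well separated places of elements avoiding `b` is boundedly many to one. -/
lemma exists_card_insert_fiber_le [DecidableEq Γ] {p q : Γ → ℕ → Γ}
    (hpq : ∀ x i, i ≤ ℓ x → p x i * q x i = x ∧ ℓ (p x i) = i ∧ i + ℓ (q x i) = ℓ x) :
    ∃ K : ℕ, ∀ (b : Γ) (n J : ℕ), J * (ℓ b + (6 * D + 2 * δ + 1)) ≤ n →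
      ∀ F : Finset Γ, (∀ x ∈ F, ℓ x = n ∧ ¬ Contains ℓ (6 * D + 2 * δ + 1) b x) → ∀ z,
      ((F ×ˢ Finset.range J).filter fun r =>
        let i := r.2 * (ℓ b + (6 * D + 2 * δ + 1))
        let m := p r.1 i * u (p r.1 i) b * b
        m * u m (q r.1 i) * q r.1 i = z).card ≤ K := by
  have h := hc.len
  refine ⟨((h.ball (4 * D + 2 * δ)).card * (h.ball D).card) * (h.ball D).card,
    fun b n J hJ F hF z => ?_⟩
  rw [← Finset.card_product, ← Finset.card_product]
  obtain ⟨E, hE⟩ : ∃ E, E = ℓ b + (6 * D + 2 * δ + 1) := ⟨_, rfl⟩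
  rw [← hE] at hJ ⊢
  set P := (F ×ˢ Finset.range J).filter fun r =>
        let i := r.2 * E
        let m := p r.1 i * u (p r.1 i) b * b
        m * u m (q r.1 i) * q r.1 i = z with hP
  have hPmem : ∀ x j, (x, j) ∈ P → ∃ i pp qq m u₁ u₂, i = j * E ∧ pp = p x i ∧ qq = q x i ∧
      u₁ = u pp b ∧ m = pp * u₁ * b ∧ u₂ = u m qq ∧ m * u₂ * qq = z ∧ pp * qq = x ∧
      ℓ pp = i ∧ i + ℓ qq = n ∧ ℓ x = n ∧ ¬ Contains ℓ (6 * D + 2 * δ + 1) b x ∧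
      ℓ m ≤ i + D + ℓ b ∧ i + ℓ b ≤ ℓ m + D ∧ ℓ m + lenDist ℓ m z ≤ ℓ z + 4 * D ∧
      ℓ pp + lenDist ℓ pp z ≤ ℓ z + 4 * D ∧ ℓ u₁ ≤ D ∧ ℓ u₂ ≤ D := by
    intro x j hxj
    simp only [hP, Finset.mem_filter, Finset.mem_product, Finset.mem_range] at hxj
    obtain ⟨⟨hxF, hj⟩, hz⟩ := hxj
    obtain ⟨hx1, hx2⟩ := hF x hxF
    have hi : j * E ≤ n := (Nat.mul_le_mul_right E hj.le).trans hJ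
    obtain ⟨e1, e2, e3⟩ := hpq x (j * E) (by omega)
    refine ⟨j * E, p x (j * E), q x (j * E), _, _, _, rfl, rfl, rfl, rfl, rfl, rfl, hz, e1, e2,
      by omega, hx1, hx2, ?_⟩
    set pp := p x (j * E)
    set qq := q x (j * E)
    have t1 := hc.short pp b
    have t2 := hc.long pp b
    have t3 := hc.short (pp * u pp b * b) qq
    have t4 := hc.long (pp * u pp b * b) qq
    have t5 := h.mul pp (u pp b * b)
    have t6 := h.mul (u pp b) b
    have t7 : lenDist ℓ (pp * u pp b * b) z = ℓ (u (pp * u pp b * b) qq * qq) := by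
      rw [← hz, mul_assoc _ (u _ qq), IsLength.dist_mul_right]
    have t8 := h.mul (u (pp * u pp b * b) qq) qq
    have t9 : lenDist ℓ pp (pp * u pp b * b) = ℓ (u pp b * b) := by
      rw [mul_assoc, IsLength.dist_mul_right]
    have t10 := h.dist_triangle pp (pp * u pp b * b) z
    rw [hz] at t4
    rw [← mul_assoc] at t5
    omega
  have hjeq : ∀ x j x' j', (x, j) ∈ P → (x', j') ∈ P → ¬ j < j' := by
    intro x j x' j' hx hx' hlt
    obtain ⟨i, pp, qq, m, u₁, u₂, hi, -, -, -, hm, -, hz, -, hi0, -, -, -, e1, e2, e3, e4, e5, -⟩ :=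
      hPmem x j hx
    obtain ⟨i', pp', qq', m', -, -, hi', -, -, -, -, -, -, hx'', f0, f1, f2, f3, -, -, -, f4, -,
      -⟩ := hPmem x' j' hx'
    have hii : i + E ≤ i' := by
      rw [hi, hi', ← Nat.succ_mul]
      exact Nat.mul_le_mul_right E hlt
    have n1 := h.near_geodesic hc.hyp e3 f4
    have n2 := h.dist_triangle m pp' x'
    have n3 : lenDist ℓ pp' x' = ℓ qq' := by rw [← hx'', IsLength.dist_mul_right]
    have n4 := h.mul pp u₁
    refine f3 ⟨pp * u₁, m⁻¹ * x', by rw [hm]; group, ?_⟩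
    have n5 : ℓ (m⁻¹ * x') = lenDist ℓ m x' := rfl
    omega
  rcases P.eq_empty_or_nonempty with he | ⟨⟨x₀, j₀⟩, h0⟩
  · rw [he]; simp
  have hj0 : ∀ x j, (x, j) ∈ P → j = j₀ := fun x j hx => by
    have h1 := hjeq _ _ _ _ hx h0
    have h2 := hjeq _ _ _ _ h0 hx
    omega
  refine Finset.card_le_card_of_injOn (fun r =>
    (((p x₀ (j₀ * E))⁻¹ * p r.1 (r.2 * E), u (p r.1 (r.2 * E)) b),
      u (p r.1 (r.2 * E) * u (p r.1 (r.2 * E)) b * b) (q r.1 (r.2 * E)))) ?_ ?_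
  · rintro ⟨x, j⟩ hxj
    obtain rfl := hj0 x j hxj
    obtain ⟨_, _, _, _, _, _, rfl, rfl, rfl, rfl, rfl, rfl, -, -, d1, -, -, -, -, -, -, d2, -, -⟩ :=
      hPmem _ _ h0
    obtain ⟨_, _, _, _, _, _, rfl, rfl, rfl, rfl, rfl, rfl, -, -, d3, -, -, -, -, -, -, d4, d5,
      d6⟩ := hPmem _ _ hxj
    simp only [Finset.coe_product, Set.mem_prod, Finset.mem_coe, h.mem_ball]
    have n1 := h.near_geodesic hc.hyp d2 d4
    have n2 : lenDist ℓ (p x₀ (j * E)) (p x (j * E)) = ℓ ((p x₀ (j * E))⁻¹ * p x (j * E)) := rfl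
    exact ⟨⟨by omega, d5⟩, d6⟩
  · rintro ⟨x, j⟩ hxj ⟨x', j'⟩ hxj' he
    obtain rfl := hj0 x j hxj
    obtain rfl := hj0 x' j' hxj'
    obtain ⟨_, _, _, _, _, _, rfl, rfl, rfl, rfl, rfl, rfl, c1, c2, -⟩ := hPmem _ _ hxj
    obtain ⟨_, _, _, _, _, _, rfl, rfl, rfl, rfl, rfl, rfl, c3, c4, -⟩ := hPmem _ _ hxj'
    simp only [Prod.mk.injEq, mul_right_inj] at he
    obtain ⟨⟨a1, a2⟩, a3⟩ := he
    have := c1.trans c3.symm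
    rw [a3, a2, a1] at this
    have hq := mul_left_cancel this
    rw [← c2, ← c4, a1, hq]

end Connecting

lemma GoodWeight.exists_bdd_nonneg {ℓ : Γ → ℕ} {f : Γ → ℝ} (hf : GoodWeight ℓ f) :
    ∃ K : ℝ, 0 ≤ K ∧ ∀ (n : ℕ) (F : Finset Γ), (∀ x ∈ F, ℓ x = n) →
      ∑ x ∈ F, Real.exp (-f x) ≤ K := by
  obtain ⟨K, hK⟩ := hf.bdd
  exact ⟨K, by simpa using hK 0 ∅ (by simp), hK⟩

/-- Exponential sums over elements containing `b` carry a factor `exp (-f b)`. -/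
lemma GoodWeight.exists_sum_contains_le {ℓ : Γ → ℕ} (h : IsLength ℓ) {f : Γ → ℝ}
    (hf : GoodWeight ℓ f) (D : ℕ) : ∃ K : ℝ, 0 ≤ K ∧ ∀ (b : Γ) (n : ℕ) (F : Finset Γ),
      (∀ x ∈ F, ℓ x = n ∧ Contains ℓ D b x) →
      ∑ x ∈ F, Real.exp (-f x) ≤ K * (n + 1) * Real.exp (-f b) := by
  classical
  obtain ⟨K, hK0, hK⟩ := hf.exists_bdd_nonneg
  obtain ⟨C, hC⟩ := hf.quasi D
  refine ⟨Real.exp (2 * C) * K ^ 2 * (D + 1) ^ 2, by positivity, fun b n F hF => ?_⟩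
  have hpq : ∀ x, ∃ p q, x ∈ F → x = p * b * q ∧ ℓ p + ℓ b + ℓ q ≤ ℓ x + D := fun x => by
    by_cases hx : x ∈ F
    · obtain ⟨p, q, hpq⟩ := (hF x hx).2
      exact ⟨p, q, fun _ => hpq⟩
    · exact ⟨1, 1, fun hx' => absurd hx' hx⟩
  choose p q hpq using hpq
  have hbound : ∀ x ∈ F, ℓ x = n ∧ ℓ x ≤ ℓ (p x) + ℓ b + ℓ (q x) ∧
      f (p x) + f b + f (q x) ≤ f x + 2 * C := by
    intro x hx
    obtain ⟨e1, e2⟩ := hpq x hx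
    have e3 := h.mul (p x * b) (q x)
    have e4 := h.mul (p x) b
    rw [← e1] at e3
    refine ⟨(hF x hx).1, by omega, ?_⟩
    have e5 := hC (p x) b (by omega)
    have e6 := hC (p x * b) (q x) (by rw [← e1]; omega)
    rw [← e1] at e6
    linarith
  have hidx : ∀ x ∈ F, (ℓ (p x), ℓ (p x) + ℓ b + ℓ (q x) - n) ∈
      Finset.range (n + D + 1) ×ˢ Finset.range (D + 1) := fun x hx => by
    have h1 := hpq x hx
    have h2 := hbound x hx
    simp only [Finset.mem_product, Finset.mem_range]
    omega
  have hpiece : ∀ r ∈ Finset.range (n + D + 1) ×ˢ Finset.range (D + 1),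
      ∑ x ∈ F with (ℓ (p x), ℓ (p x) + ℓ b + ℓ (q x) - n) = r, Real.exp (-f x) ≤
        Real.exp (2 * C) * Real.exp (-f b) * (K * K) := by
    rintro ⟨i, t⟩ -
    set F' := F.filter fun x => (ℓ (p x), ℓ (p x) + ℓ b + ℓ (q x) - n) = (i, t) with hF'
    have hm : ∀ x ∈ F', x ∈ F ∧ ℓ (p x) = i ∧ ℓ (p x) + ℓ b + ℓ (q x) - n = t := fun x hx => by
      simpa [hF'] using hx
    calc ∑ x ∈ F', Real.exp (-f x)
        ≤ ∑ x ∈ F', Real.exp (2 * C) * Real.exp (-f b) *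
            (Real.exp (-f (p x)) * Real.exp (-f (q x))) := by
          refine Finset.sum_le_sum fun x hx => ?_
          rw [← Real.exp_add, ← Real.exp_add, ← Real.exp_add]
          refine Real.exp_le_exp.2 ?_
          have := (hbound x (hm x hx).1).2.2
          linarith
      _ = Real.exp (2 * C) * Real.exp (-f b) *
            ∑ r ∈ F'.image (fun x => (p x, q x)), Real.exp (-f r.1) * Real.exp (-f r.2) := by
          rw [Finset.mul_sum, Finset.sum_image]
          intro x hx x' hx' he
          simp only [Prod.mk.injEq] at he
          rw [(hpq x (hm x hx).1).1, (hpq x' (hm x' hx').1).1, he.1, he.2]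
      _ ≤ Real.exp (2 * C) * Real.exp (-f b) *
            ∑ r ∈ F'.image p ×ˢ F'.image q, Real.exp (-f r.1) * Real.exp (-f r.2) := by
          refine mul_le_mul_of_nonneg_left ?_ (by positivity)
          refine Finset.sum_le_sum_of_subset_of_nonneg ?_ fun _ _ _ => by positivity
          intro r hr
          obtain ⟨x, hx, rfl⟩ := Finset.mem_image.1 hr
          exact Finset.mem_product.2 ⟨Finset.mem_image_of_mem _ hx, Finset.mem_image_of_mem _ hx⟩
      _ ≤ Real.exp (2 * C) * Real.exp (-f b) * (K * K) := by
          refine mul_le_mul_of_nonneg_left ?_ (by positivity)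
          rw [Finset.sum_product]
          dsimp only
          rw [← Finset.sum_mul_sum]
          refine mul_le_mul (hK i _ fun y hy => ?_) (hK (n + t - ℓ b - i) _ fun y hy => ?_)
            (Finset.sum_nonneg fun _ _ => (Real.exp_pos _).le) hK0
          · obtain ⟨x, hx, rfl⟩ := Finset.mem_image.1 hy
            exact (hm x hx).2.1
          · obtain ⟨x, hx, rfl⟩ := Finset.mem_image.1 hy
            have h1 := hm x hx
            have h2 := hbound x h1.1
            omega
  rw [← Finset.sum_fiberwise_of_maps_to hidx]
  refine (Finset.sum_le_sum hpiece).trans ?_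
  rw [Finset.sum_const, Finset.card_product, Finset.card_range, Finset.card_range, nsmul_eq_mul]
  push_cast
  have h1 : ((n : ℝ) + D + 1) ≤ (D + 1) * (n + 1) := by
    have : (0 : ℝ) ≤ D * n := by positivity
    linarith
  calc ((n : ℝ) + D + 1) * (D + 1) * (Real.exp (2 * C) * Real.exp (-f b) * (K * K))
      ≤ ((D + 1) * (n + 1)) * (D + 1) * (Real.exp (2 * C) * Real.exp (-f b) * (K * K)) := by
        gcongr
    _ = _ := by ring

/-- Exponential sums over elements avoiding `b` are small when the length is large. -/
lemma Connecting.exists_sum_avoid_le {ℓ : Γ → ℕ} {δ D : ℕ} {u : Γ → Γ → Γ}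
    (hc : Connecting ℓ δ D u) {f : Γ → ℝ} (hf : GoodWeight ℓ f) :
    ∃ K : ℝ, 0 ≤ K ∧ ∀ (b : Γ) (n J : ℕ), J * (ℓ b + (6 * D + 2 * δ + 1)) ≤ n →
      ∀ F : Finset Γ, (∀ x ∈ F, ℓ x = n ∧ ¬ Contains ℓ (6 * D + 2 * δ + 1) b x) →
      (∑ x ∈ F, Real.exp (-f x)) * J * Real.exp (-f b) ≤ K := by
  classical
  have h := hc.len
  obtain ⟨p, q, hpq⟩ := h.exists_split_fun
  obtain ⟨K₁, hK₁⟩ := hc.exists_card_insert_fiber_le hpq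
  obtain ⟨K, hK0, hK⟩ := hf.exists_bdd_nonneg
  obtain ⟨C₀, hC₀⟩ := hf.quasi 0
  obtain ⟨C, hC0, hC⟩ := h.exists_bound_on_ball hf.nonneg D
  refine ⟨Real.exp (2 * C + C₀) * (K₁ * ((4 * D + 1) * K)), by positivity,
    fun b n J hJ F hF => ?_⟩
  have hfib := hK₁ b n J hJ F hF
  obtain ⟨E, hE⟩ : ∃ E, E = ℓ b + (6 * D + 2 * δ + 1) := ⟨_, rfl⟩
  rw [← hE] at hJ
  rw [← hE] at hfib
  set φ : Γ × ℕ → Γ := fun r =>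
    p r.1 (r.2 * E) * u (p r.1 (r.2 * E)) b * b *
      u (p r.1 (r.2 * E) * u (p r.1 (r.2 * E)) b * b) (q r.1 (r.2 * E)) * q r.1 (r.2 * E) with hφ
  have h1 := sum_comp_le_of_card_fiber_le (P := F ×ˢ Finset.range J) (φ := φ)
    (G := fun z => Real.exp (-f z)) (fun z => (Real.exp_pos _).le) hfib
  have hφ' : ∀ r ∈ F ×ˢ Finset.range J, n + ℓ b ≤ ℓ (φ r) + 2 * D ∧
      ℓ (φ r) ≤ n + ℓ b + 2 * D ∧ f (φ r) ≤ f r.1 + f b + 2 * C + C₀ := by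
    rintro ⟨x, j⟩ hxj
    simp only [Finset.mem_product, Finset.mem_range] at hxj
    have hi : j * E ≤ n := (Nat.mul_le_mul_right E hxj.2.le).trans hJ
    have hx := (hF x hxj.1).1
    obtain ⟨e1, e2, e3⟩ := hpq x (j * E) (by omega)
    simp only [hφ]
    set pp := p x (j * E)
    set qq := q x (j * E)
    have t1 := hc.short pp b
    have t2 := hc.long pp b
    have t3 := hc.short (pp * u pp b * b) qq
    have t4 := hc.long (pp * u pp b * b) qq
    have t5 := h.mul (pp * u pp b * b * u (pp * u pp b * b) qq) qq
    have t6 := h.mul (pp * u pp b * b) (u (pp * u pp b * b) qq)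
    have t7 := h.mul (pp * u pp b) b
    have t8 := h.mul pp (u pp b)
    refine ⟨by omega, by omega, ?_⟩
    have s5 := hf.sub (pp * u pp b * b * u (pp * u pp b * b) qq) qq
    have s6 := hf.sub (pp * u pp b * b) (u (pp * u pp b * b) qq)
    have s7 := hf.sub (pp * u pp b) b
    have s8 := hf.sub pp (u pp b)
    have s1 := hC _ t1
    have s3 := hC _ t3
    have s9 := hC₀ pp qq (by rw [e1]; omega)
    rw [e1] at s9
    linarith
  have h2 : (∑ x ∈ F, Real.exp (-f x)) * J * Real.exp (-f b) ≤
      Real.exp (2 * C + C₀) * ∑ r ∈ F ×ˢ Finset.range J, Real.exp (-f (φ r)) := by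
    have : (∑ x ∈ F, Real.exp (-f x)) * J * Real.exp (-f b) =
        ∑ r ∈ F ×ˢ Finset.range J, Real.exp (-f r.1) * Real.exp (-f b) := by
      rw [Finset.sum_product, Finset.sum_mul, Finset.sum_mul]
      refine Finset.sum_congr rfl fun x _ => ?_
      dsimp only
      rw [Finset.sum_const, Finset.card_range, nsmul_eq_mul]
      ring
    rw [this, Finset.mul_sum]
    refine Finset.sum_le_sum fun r hr => ?_
    rw [← Real.exp_add, ← Real.exp_add]
    have := (hφ' r hr).2.2
    exact Real.exp_le_exp.2 (by linarith)
  have h3 : ∑ z ∈ (F ×ˢ Finset.range J).image φ, Real.exp (-f z) ≤ (4 * D + 1) * K := by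
    have hmap : ∀ z ∈ (F ×ˢ Finset.range J).image φ,
        ℓ z + 2 * D - (n + ℓ b) ∈ Finset.range (4 * D + 1) := fun z hz => by
      obtain ⟨r, hr, rfl⟩ := Finset.mem_image.1 hz
      have := hφ' r hr
      rw [Finset.mem_range]
      omega
    rw [← Finset.sum_fiberwise_of_maps_to hmap]
    refine (Finset.sum_le_sum (g := fun _ => K) fun t _ =>
      hK (n + ℓ b + t - 2 * D) _ fun z hz => ?_).trans ?_
    · rw [Finset.mem_filter] at hz
      obtain ⟨r, hr, rfl⟩ := Finset.mem_image.1 hz.1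
      have := hφ' r hr
      omega
    · rw [Finset.sum_const, Finset.card_range, nsmul_eq_mul]
      push_cast
      exact le_rfl
  refine h2.trans (mul_le_mul_of_nonneg_left (h1.trans ?_) (Real.exp_pos _).le)
  exact mul_le_mul_of_nonneg_left h3 (Nat.cast_nonneg _)

/-- An unbounded difference of good weights grows linearly along suitable elements. -/
lemma Connecting.exists_large_gap {ℓ : Γ → ℕ} {δ D : ℕ} {u : Γ → Γ → Γ}
    (hc : Connecting ℓ δ D u) {f₁ f₂ : Γ → ℝ} (hf₁ : GoodWeight ℓ f₁) (hf₂ : GoodWeight ℓ f₂)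
    (hgap : ∀ C : ℝ, ∃ x, C ≤ f₂ x - f₁ x) :
    ∃ B : ℕ, ∀ k : ℕ, ∃ b, (k : ℝ) ≤ f₂ b - f₁ b ∧ ℓ b ≤ (k + 1) * B := by
  have h := hc.len
  obtain ⟨C₁, hC₁, hb₁⟩ := h.exists_bound_on_ball hf₁.nonneg D
  obtain ⟨C₂, hC₂, hb₂⟩ := h.exists_bound_on_ball hf₂.nonneg D
  obtain ⟨C, hC⟩ := hf₂.quasi (2 * D)
  obtain ⟨x₀, hx₀⟩ := hgap (max 0 (C₁ + C₂ + C + 1))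
  have hx₁ := (le_max_left _ _).trans hx₀
  have hx₂ := (le_max_right _ _).trans hx₀
  refine ⟨ℓ x₀ + D, fun k => ?_⟩
  induction k with
  | zero => exact ⟨x₀, by simpa using hx₁, by omega⟩
  | succ k ih =>
    obtain ⟨b, hb, hbl⟩ := ih
    refine ⟨b * u b x₀ * x₀, ?_, ?_⟩
    · have t1 := hc.short b x₀
      have t2 := hc.long b x₀
      have t3 := h.mul (u b x₀) x₀
      have t4 := hC b (u b x₀ * x₀) (by rw [← mul_assoc]; omega)
      rw [← mul_assoc] at t4
      have t5 := hf₂.sub (u b x₀)⁻¹ (u b x₀ * x₀)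
      rw [inv_mul_cancel_left] at t5
      have t6 := hb₂ (u b x₀)⁻¹ (by rwa [h.inv])
      have t7 := hb₁ _ t1
      have t8 := hf₁.sub (b * u b x₀) x₀
      have t9 := hf₁.sub b (u b x₀)
      push_cast
      linarith
    · have t1 := hc.short b x₀
      have t3 := h.mul (b * u b x₀) x₀
      have t4 := h.mul b (u b x₀)
      have : (k + 1 + 1) * (ℓ x₀ + D) = (k + 1) * (ℓ x₀ + D) + (ℓ x₀ + D) := by ring
      omega

lemma exp_neg_half_add_le {a b t : ℝ} (ht : 0 < t) :
    Real.exp (-((a + b) / 2)) ≤ t * Real.exp (-a) + Real.exp (-b) / t := by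
  have h1 : Real.exp (-a) = Real.exp (-a / 2) ^ 2 := by
    rw [← Real.exp_nat_mul]; congr 1; push_cast; ring
  have h2 : Real.exp (-b) = Real.exp (-b / 2) ^ 2 := by
    rw [← Real.exp_nat_mul]; congr 1; push_cast; ring
  have h3 : Real.exp (-((a + b) / 2)) = Real.exp (-a / 2) * Real.exp (-b / 2) := by
    rw [← Real.exp_add]; congr 1; ring
  rw [h1, h2, h3]
  have hp := Real.exp_pos (-a / 2)
  have hq := Real.exp_pos (-b / 2)
  set p := Real.exp (-a / 2)
  set q := Real.exp (-b / 2)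
  rw [← sub_nonneg]
  have : t * p ^ 2 + q ^ 2 / t - p * q = ((t * p - q) ^ 2 + t * p * q) / t := by
    field_simp; ring
  rw [this]
  positivity

lemma succ_mul_exp_neg_le (k : ℕ) : ((k : ℝ) + 1) * Real.exp (-k) ≤ 4 / (k + 1) := by
  have h1 := Real.add_one_le_exp ((k : ℝ) / 2)
  have h2 : Real.exp (k : ℝ) = Real.exp ((k : ℝ) / 2) ^ 2 := by
    rw [← Real.exp_nat_mul]; congr 1; push_cast; ring
  have h3 : ((k : ℝ) + 1) / 2 ≤ Real.exp ((k : ℝ) / 2) := by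
    have : (0 : ℝ) ≤ k := k.cast_nonneg
    linarith
  have h4 : (((k : ℝ) + 1) / 2) ^ 2 ≤ Real.exp (k : ℝ) := by
    rw [h2]; gcongr
  rw [Real.exp_neg, ← div_eq_mul_inv, div_le_div_iff₀ (Real.exp_pos _) (by positivity)]
  nlinarith

/-- The affinity of two good weights with unbounded difference is small on some sphere. -/
lemma Connecting.exists_affinity_le {ℓ : Γ → ℕ} {δ D : ℕ} {u : Γ → Γ → Γ}
    (hc : Connecting ℓ δ D u) {f₁ f₂ : Γ → ℝ} (hf₁ : GoodWeight ℓ f₁) (hf₂ : GoodWeight ℓ f₂)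
    (hgap : ∀ C : ℝ, ∃ x, C ≤ f₂ x - f₁ x) {ε : ℝ} (hε : 0 < ε) :
    ∃ n, 1 ≤ n ∧ ∑ x ∈ hc.len.sphere n, Real.exp (-((f₁ x + f₂ x) / 2)) ≤ ε := by
  classical
  have h := hc.len
  obtain ⟨B, hB⟩ := hc.exists_large_gap hf₁ hf₂ hgap
  obtain ⟨K₁, hK₁, hb₁⟩ := hf₁.exists_bdd_nonneg
  obtain ⟨K₂, hK₂, hb₂⟩ := hf₂.exists_bdd_nonneg
  obtain ⟨M₁, hM₁, ha⟩ := hc.exists_sum_avoid_le hf₁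
  obtain ⟨M₂, hM₂, hm⟩ := hf₂.exists_sum_contains_le h (6 * D + 2 * δ + 1)
  obtain ⟨t, ht⟩ : ∃ t, t = 4 * (K₁ + K₂) / ε + 1 := ⟨_, rfl⟩
  have ht0 : 0 < t := by rw [ht]; positivity
  obtain ⟨T, hT⟩ := exists_nat_gt (4 * t * M₁ / ε)
  have hT0 : (0 : ℝ) < T := lt_of_le_of_lt (by positivity) hT
  obtain ⟨c, hcc⟩ : ∃ c : ℕ, c = B + (6 * D + 2 * δ + 1) := ⟨_, rfl⟩
  obtain ⟨k, hk⟩ := exists_nat_gt (4 * t * (M₂ * (2 * (T + 1) * c) * 4) / ε)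
  obtain ⟨b, hbk, hbl⟩ := hB k
  obtain ⟨E, hE⟩ : ∃ E, E = ℓ b + (6 * D + 2 * δ + 1) := ⟨_, rfl⟩
  obtain ⟨J, hJ⟩ : ∃ J, J = ⌈T * Real.exp (f₁ b)⌉₊ := ⟨_, rfl⟩
  have hJ1 : T * Real.exp (f₁ b) ≤ J := hJ ▸ Nat.le_ceil _
  have hJ0 : (0 : ℝ) < J := lt_of_lt_of_le (by positivity) hJ1
  have hJ1' : 1 ≤ J := by exact_mod_cast hJ0
  have hJ2 : (J : ℝ) ≤ (T + 1) * Real.exp (f₁ b) := by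
    have h1 := (Nat.ceil_lt_add_one (a := T * Real.exp (f₁ b)) (by positivity)).le
    rw [← hJ] at h1
    have h2 := Real.one_le_exp (hf₁.nonneg b)
    linarith
  have hE1 : 1 ≤ E := by omega
  have hEc : (E : ℝ) ≤ (k + 1) * c := by
    have : E ≤ (k + 1) * c := by
      rw [hcc, mul_add]
      have : 6 * D + 2 * δ + 1 ≤ (k + 1) * (6 * D + 2 * δ + 1) :=
        Nat.le_mul_of_pos_left _ k.succ_pos
      omega
    exact_mod_cast this
  refine ⟨J * E, Nat.mul_pos hJ1' hE1, ?_⟩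
  set X := h.sphere (J * E) with hX
  set X₁ := X.filter fun x => Contains ℓ (6 * D + 2 * δ + 1) b x with hX₁
  set X₂ := X.filter fun x => ¬ Contains ℓ (6 * D + 2 * δ + 1) b x with hX₂
  have hX₁m : ∀ x ∈ X₁, ℓ x = J * E ∧ Contains ℓ (6 * D + 2 * δ + 1) b x := fun x hx => by
    simpa [hX₁, hX] using hx
  have hX₂m : ∀ x ∈ X₂, ℓ x = J * E ∧ ¬ Contains ℓ (6 * D + 2 * δ + 1) b x := fun x hx => by
    simpa [hX₂, hX] using hx
  have s₂ : ∑ x ∈ X₂, Real.exp (-((f₁ x + f₂ x) / 2)) ≤ t * (M₁ / T) + K₂ / t := by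
    refine (Finset.sum_le_sum fun x _ => exp_neg_half_add_le ht0).trans ?_
    rw [Finset.sum_add_distrib, ← Finset.mul_sum, ← Finset.sum_div]
    refine add_le_add (mul_le_mul_of_nonneg_left ?_ ht0.le)
      (div_le_div_of_nonneg_right (hb₂ _ _ fun x hx => (hX₂m x hx).1) ht0.le)
    have h1 := ha b (J * E) J (by rw [hE]) X₂ hX₂m
    rw [le_div_iff₀ hT0]
    refine le_trans ?_ h1
    rw [mul_assoc]
    refine mul_le_mul_of_nonneg_left ?_ (Finset.sum_nonneg fun _ _ => (Real.exp_pos _).le)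
    rw [Real.exp_neg, ← div_eq_mul_inv, le_div_iff₀ (Real.exp_pos _)]
    exact hJ1
  have s₁ : ∑ x ∈ X₁, Real.exp (-((f₁ x + f₂ x) / 2)) ≤
      t * (M₂ * (2 * (T + 1) * c) * 4 / (k + 1)) + K₁ / t := by
    simp only [add_comm (f₁ _)]
    refine (Finset.sum_le_sum fun x _ => exp_neg_half_add_le ht0).trans ?_
    rw [Finset.sum_add_distrib, ← Finset.mul_sum, ← Finset.sum_div]
    refine add_le_add (mul_le_mul_of_nonneg_left ?_ ht0.le)
      (div_le_div_of_nonneg_right (hb₁ _ _ fun x hx => (hX₁m x hx).1) ht0.le)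
    refine (hm b (J * E) X₁ hX₁m).trans ?_
    rw [mul_assoc, mul_assoc M₂, mul_div_assoc, mul_div_assoc]
    refine mul_le_mul_of_nonneg_left ?_ hM₂
    have h1 : ((J * E : ℕ) : ℝ) + 1 ≤ 2 * (J * E) := by
      have : (1 : ℝ) ≤ ((J * E : ℕ) : ℝ) := by exact_mod_cast Nat.mul_pos hJ1' hE1
      push_cast at this ⊢
      linarith
    calc (((J * E : ℕ) : ℝ) + 1) * Real.exp (-f₂ b)
        ≤ 2 * (((T + 1) * Real.exp (f₁ b)) * ((k + 1) * c)) * Real.exp (-f₂ b) := by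
          refine mul_le_mul_of_nonneg_right (h1.trans ?_) (Real.exp_pos _).le
          gcongr
      _ = 2 * (T + 1) * c * ((k + 1) * Real.exp (-(f₂ b - f₁ b))) := by
          rw [neg_sub, sub_eq_add_neg, Real.exp_add]; ring
      _ ≤ 2 * (T + 1) * c * ((k + 1) * Real.exp (-k)) := by gcongr
      _ ≤ 2 * (T + 1) * c * (4 / (k + 1)) :=
          mul_le_mul_of_nonneg_left (succ_mul_exp_neg_le k) (by positivity)
  have e1 : t * (M₁ / T) ≤ ε / 4 := by
    rw [div_lt_iff₀ hε] at hT
    rw [← mul_div_assoc, div_le_iff₀ hT0]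
    linarith
  have e2 : t * (M₂ * (2 * (T + 1) * c) * 4 / (k + 1)) ≤ ε / 4 := by
    rw [div_lt_iff₀ hε] at hk
    rw [← mul_div_assoc, div_le_iff₀ (by positivity)]
    linarith
  have e3 : (K₁ + K₂) / t ≤ ε / 4 := by
    rw [div_le_iff₀ ht0, ht, mul_add]
    have : ε / 4 * (4 * (K₁ + K₂) / ε) = K₁ + K₂ := by field_simp
    linarith
  rw [add_div] at e3
  have := Finset.sum_filter_add_sum_filter_not X
    (fun x => Contains ℓ (6 * D + 2 * δ + 1) b x) fun x => Real.exp (-((f₁ x + f₂ x) / 2))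
  rw [← this]
  linarith

/-- Exponential sums of a weight additive along geodesics are submultiplicative. -/
lemma IsLength.sum_sphere_add_le {ℓ : Γ → ℕ} (h : IsLength ℓ) {g : Γ → ℝ} {C : ℝ}
    (hg : ∀ x y, ℓ x + ℓ y = ℓ (x * y) → g x + g y ≤ g (x * y) + C) (m n : ℕ) :
    ∑ x ∈ h.sphere (m + n), Real.exp (-g x) ≤
      Real.exp C * (∑ x ∈ h.sphere m, Real.exp (-g x)) * ∑ x ∈ h.sphere n, Real.exp (-g x) := by
  classical
  obtain ⟨p, q, hpq⟩ := h.exists_split_fun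
  have hm : ∀ x ∈ h.sphere (m + n), p x m * q x m = x ∧ ℓ (p x m) = m ∧ ℓ (q x m) = n := by
    intro x hx
    rw [h.mem_sphere] at hx
    obtain ⟨e1, e2, e3⟩ := hpq x m (by omega)
    exact ⟨e1, e2, by omega⟩
  calc ∑ x ∈ h.sphere (m + n), Real.exp (-g x)
      ≤ ∑ x ∈ h.sphere (m + n), Real.exp C * (Real.exp (-g (p x m)) * Real.exp (-g (q x m))) := by
        refine Finset.sum_le_sum fun x hx => ?_
        obtain ⟨e1, e2, e3⟩ := hm x hx
        rw [h.mem_sphere] at hx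
        have := hg (p x m) (q x m) (by rw [e1]; omega)
        rw [e1] at this
        rw [← Real.exp_add, ← Real.exp_add]
        exact Real.exp_le_exp.2 (by linarith)
    _ = Real.exp C * ∑ r ∈ (h.sphere (m + n)).image fun x => (p x m, q x m),
          Real.exp (-g r.1) * Real.exp (-g r.2) := by
        rw [Finset.mul_sum, Finset.sum_image]
        intro x hx x' hx' he
        simp only [Prod.mk.injEq] at he
        rw [← (hm x hx).1, ← (hm x' hx').1, he.1, he.2]
    _ ≤ Real.exp C * ∑ r ∈ h.sphere m ×ˢ h.sphere n, Real.exp (-g r.1) * Real.exp (-g r.2) := by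
        refine mul_le_mul_of_nonneg_left ?_ (Real.exp_pos _).le
        refine Finset.sum_le_sum_of_subset_of_nonneg ?_ fun _ _ _ => by positivity
        intro r hr
        obtain ⟨x, hx, rfl⟩ := Finset.mem_image.1 hr
        simpa using (hm x hx).2
    _ = _ := by
        rw [Finset.sum_product]
        dsimp only
        rw [← Finset.sum_mul_sum, mul_assoc]

/-- Exponential decay for submultiplicative sequences that become small. -/
lemma exists_exp_decay {Z : ℕ → ℝ} (hZ : ∀ n, 0 ≤ Z n) {C K : ℝ}
    (hK : ∀ n, Z n ≤ K) (hsub : ∀ m n, Z (m + n) ≤ Real.exp C * Z m * Z n) {n : ℕ} (hn : 1 ≤ n)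
    (hsmall : Z n ≤ Real.exp (-C - 1)) :
    ∃ A θ : ℝ, 0 < θ ∧ ∀ m : ℕ, Z m ≤ A * Real.exp (-(θ * m)) := by
  have hn0 : (0 : ℝ) < n := by exact_mod_cast hn
  have hstep : ∀ m, Z (n + m) ≤ Real.exp (-1) * Z m := fun m => by
    refine (hsub n m).trans (mul_le_mul_of_nonneg_right ?_ (hZ m))
    calc Real.exp C * Z n ≤ Real.exp C * Real.exp (-C - 1) := by gcongr
      _ = Real.exp (-1) := by rw [← Real.exp_add]; congr 1; ring
  have hiter : ∀ j r : ℕ, Z (n * j + r) ≤ Real.exp (-(j : ℝ)) * Z r := by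
    intro j r
    induction j with
    | zero => simp
    | succ j ih =>
      rw [show n * (j + 1) + r = n + (n * j + r) by ring]
      refine (hstep _).trans ((mul_le_mul_of_nonneg_left ih (Real.exp_pos _).le).trans ?_)
      rw [← mul_assoc, ← Real.exp_add]
      push_cast
      rw [neg_add, add_comm]
  refine ⟨Real.exp 1 * K, 1 / n, by positivity, fun m => ?_⟩
  have h1 := hiter (m / n) (m % n)
  rw [Nat.div_add_mod] at h1
  have h2 : (m : ℝ) ≤ n * ((m / n : ℕ) + 1) := by
    exact_mod_cast (Nat.lt_mul_div_succ m (by omega)).le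
  have h3 : 1 / (n : ℝ) * m ≤ (m / n : ℕ) + 1 := by
    rw [one_div_mul_eq_div, div_le_iff₀ hn0]
    linarith
  have h0 : 0 ≤ K := (hZ 0).trans (hK 0)
  calc Z m ≤ Real.exp (-((m / n : ℕ) : ℝ)) * K :=
        h1.trans (mul_le_mul_of_nonneg_left (hK _) (Real.exp_pos _).le)
    _ ≤ Real.exp (1 + -(1 / (n : ℝ) * m)) * K := by gcongr; linarith
    _ = _ := by rw [Real.exp_add]; ring

/-- The affinity of two good weights with unbounded difference decays exponentially. -/
lemma Connecting.exists_affinity_decay {ℓ : Γ → ℕ} {δ D : ℕ} {u : Γ → Γ → Γ}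
    (hc : Connecting ℓ δ D u) {f₁ f₂ : Γ → ℝ} (hf₁ : GoodWeight ℓ f₁) (hf₂ : GoodWeight ℓ f₂)
    (hgap : ∀ C : ℝ, ∃ x, C ≤ f₂ x - f₁ x) :
    ∃ A θ : ℝ, 0 < θ ∧ ∀ m : ℕ,
      ∑ x ∈ hc.len.sphere m, Real.exp (-((f₁ x + f₂ x) / 2)) ≤ A * Real.exp (-(θ * m)) := by
  have h := hc.len
  obtain ⟨C₁, hC₁⟩ := hf₁.quasi 0
  obtain ⟨C₂, hC₂⟩ := hf₂.quasi 0
  obtain ⟨K₁, hK₁⟩ := hf₁.bdd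
  obtain ⟨K₂, hK₂⟩ := hf₂.bdd
  obtain ⟨n, hn, hsmall⟩ :=
    hc.exists_affinity_le hf₁ hf₂ hgap (Real.exp_pos (-((C₁ + C₂) / 2) - 1))
  refine exists_exp_decay (Z := fun m => ∑ x ∈ hc.len.sphere m, Real.exp (-((f₁ x + f₂ x) / 2)))
    (fun m => Finset.sum_nonneg fun _ _ => (Real.exp_pos _).le) (K := K₁ + K₂) (fun m => ?_)
    (h.sum_sphere_add_le (g := fun x => (f₁ x + f₂ x) / 2) fun x y hxy => ?_) hn hsmall
  · refine (Finset.sum_le_sum fun x _ => exp_neg_half_add_le one_pos).trans ?_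
    simp only [one_mul, div_one]
    rw [Finset.sum_add_distrib]
    exact add_le_add (hK₁ m _ fun x hx => h.mem_sphere.1 hx) (hK₂ m _ fun x hx => h.mem_sphere.1 hx)
  · have h1 := hC₁ x y (by omega)
    have h2 := hC₂ x y (by omega)
    linarith

lemma card_mul_exp_avg_le {ι : Type*} (s : Finset ι) (g : ι → ℝ) :
    (s.card : ℝ) * Real.exp ((∑ x ∈ s, g x) / s.card) ≤ ∑ x ∈ s, Real.exp (g x) := by
  rcases s.eq_empty_or_nonempty with rfl | hs
  · simp
  have hc : (0 : ℝ) < s.card := by exact_mod_cast hs.card_pos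
  set a := (∑ x ∈ s, g x) / s.card with ha
  have h1 : ∀ x ∈ s, Real.exp a * (1 + (g x - a)) ≤ Real.exp (g x) := fun x _ => by
    have h2 := Real.add_one_le_exp (g x - a)
    calc Real.exp a * (1 + (g x - a)) ≤ Real.exp a * Real.exp (g x - a) := by
          gcongr; linarith
      _ = Real.exp (g x) := by rw [← Real.exp_add]; congr 1; ring
  refine le_trans (le_of_eq ?_) (Finset.sum_le_sum h1)
  rw [← Finset.mul_sum, Finset.sum_add_distrib, Finset.sum_sub_distrib]
  simp only [Finset.sum_const, nsmul_eq_mul, mul_one]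
  have : (s.card : ℝ) * a = ∑ x ∈ s, g x := by rw [ha]; field_simp
  rw [← this]; ring

/-- The average of one length function over the sphere of radius `n` of another. -/
noncomputable def IsLength.avg {ℓ : Γ → ℕ} (h : IsLength ℓ) (ℓ' : Γ → ℕ) (n : ℕ) : ℝ :=
  (∑ x ∈ h.sphere n, (ℓ' x : ℝ)) / (h.sphere n).card

section

variable {ℓ ℓ' ℓ₀ : Γ → ℕ} (h : IsLength ℓ) (h' : IsLength ℓ') (h₀ : IsLength ℓ₀)

lemma IsLength.avg_div_le {L : ℕ} (hL : ∀ x, ℓ' x ≤ L * ℓ x) (n : ℕ) : h.avg ℓ' n / n ≤ L := by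
  refine div_le_of_le_mul₀ n.cast_nonneg L.cast_nonneg ?_
  refine div_le_of_le_mul₀ (Nat.cast_nonneg _) (by positivity) ?_
  refine (Finset.sum_le_card_nsmul _ _ ((L : ℝ) * n) fun x hx => ?_).trans_eq
    (by rw [nsmul_eq_mul, mul_comm])
  rw [← h.mem_sphere.1 hx]
  exact_mod_cast hL x

include h in
lemma IsLength.sum_sphere_le_of_comparable {L : ℕ} (hL0 : 0 < L) (hL : ∀ x, ℓ₀ x ≤ L * ℓ x)
    (hL' : ∀ x, ℓ x ≤ L * ℓ₀ x) {G : Γ → ℝ} (hG : ∀ x, 0 ≤ G x) {A θ : ℝ} (hθ : 0 ≤ θ)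
    (hA : ∀ m : ℕ, ∑ x ∈ h₀.sphere m, G x ≤ A * Real.exp (-(θ * m))) (N : ℕ) :
    ∑ x ∈ h.sphere N, G x ≤ (L * N + 1) * (A * Real.exp (-(θ * (N / L)))) := by
  classical
  have hA0 : 0 ≤ A := by
    have := (Finset.sum_nonneg fun x _ => hG x).trans (hA 0)
    simpa using this
  have hL0' : (0 : ℝ) < L := by exact_mod_cast hL0
  have hmap : ∀ x ∈ h.sphere N, ℓ₀ x ∈ Finset.range (L * N + 1) := fun x hx => by
    have := hL x
    rw [h.mem_sphere.1 hx] at this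
    rw [Finset.mem_range]
    omega
  rw [← Finset.sum_fiberwise_of_maps_to hmap]
  refine (Finset.sum_le_card_nsmul _ _ (A * Real.exp (-(θ * (N / L)))) fun m _ => ?_).trans_eq
    (by rw [Finset.card_range, nsmul_eq_mul]; push_cast; rfl)
  by_cases hm : N ≤ L * m
  · refine (Finset.sum_le_sum_of_subset_of_nonneg (t := h₀.sphere m) (fun x hx => ?_)
      fun x _ _ => hG x).trans ((hA m).trans ?_)
    · simpa using (Finset.mem_filter.1 hx).2
    · have : (N : ℝ) / L ≤ m := by
        rw [div_le_iff₀ hL0', mul_comm]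
        exact_mod_cast hm
      gcongr
  · rw [Finset.sum_eq_zero]
    · positivity
    · intro x hx
      rw [Finset.mem_filter, h.mem_sphere] at hx
      have := hL' x
      rw [hx.1, hx.2] at this
      exact absurd this hm

lemma tendsto_log_div_atTop (L A : ℝ) (hL : 0 < L) (hA : 0 < A) :
    Tendsto (fun N : ℕ => Real.log ((L * N + 1) * A) / N) atTop (𝓝 0) := by
  have h1 : Tendsto (fun N : ℕ => (L * N + 1) * A) atTop atTop := by
    refine Tendsto.atTop_mul_const hA (tendsto_atTop_add_const_right _ _ ?_)
    exact tendsto_natCast_atTop_atTop.const_mul_atTop hL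
  have h2 : (id ∘ fun N : ℕ => (L * N + 1) * A) =O[atTop] fun N : ℕ => (N : ℝ) := by
    refine Asymptotics.IsBigO.of_bound ((L + 1) * A) ?_
    filter_upwards [eventually_ge_atTop 1] with N hN
    have hN' : (1 : ℝ) ≤ N := by exact_mod_cast hN
    simp only [Function.comp, id]
    rw [Real.norm_of_nonneg (by positivity), Real.norm_of_nonneg (by positivity)]
    nlinarith
  exact ((Real.isLittleO_log_id_atTop.comp_tendsto h1).trans_isBigO h2).tendsto_div_nhds_zero

/-- An exponential estimate on spheres of one length function bounds from below the mean of
another length function on the spheres of a third one. -/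
lemma IsLength.le_liminf_avg {L : ℕ} (hL0 : 0 < L) (hL : ∀ x, ℓ₀ x ≤ L * ℓ x)
    (hL' : ∀ x, ℓ x ≤ L * ℓ₀ x) {L' : ℕ} (hL'' : ∀ x, ℓ' x ≤ L' * ℓ x)
    (hv : 0 < lenGrowth ℓ) {w t θ A : ℝ} (hw : 0 < w) (ht : 0 < t) (hθ : 0 ≤ θ)
    (hA : ∀ m : ℕ, ∑ x ∈ h₀.sphere m,
      Real.exp (-(lenGrowth ℓ * ℓ x + t * (w * ℓ' x - lenGrowth ℓ * ℓ x))) ≤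
        A * Real.exp (-(θ * m))) :
    lenGrowth ℓ / w + θ / (t * L * w) ≤ liminf (fun n : ℕ => h.avg ℓ' n / n) atTop := by
  set v := lenGrowth ℓ with hvdef
  have hL0' : (0 : ℝ) < L := by exact_mod_cast hL0
  have hA0 : 0 < A := by
    have h1 : Real.exp (-(v * ℓ 1 + t * (w * ℓ' 1 - v * ℓ 1))) ≤ _ :=
      (Finset.single_le_sum (f := fun x => Real.exp (-(v * ℓ x + t * (w * ℓ' x - v * ℓ x))))
        (fun x _ => (Real.exp_pos _).le) (h₀.mem_sphere.2 h₀.one)).trans (hA 0)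
    have := (Real.exp_pos _).trans_le h1
    simpa using this
  have key : ∀ N : ℕ, Real.exp (-(t * (w * h.avg ℓ' N - v * N))) ≤
      (L * N + 1) * (A * Real.exp (-(θ * (N / L)))) := fun N => by
    refine le_trans ?_
      (h.sum_sphere_le_of_comparable h₀ hL0 hL hL' (fun x => (Real.exp_pos _).le) hθ hA N)
    have hcard := h.exp_le_card_sphere hv N
    have hc0 : (0 : ℝ) < (h.sphere N).card := (Real.exp_pos _).trans_le hcard
    refine le_trans ?_ (card_mul_exp_avg_le _ _)
    have e1 : (∑ x ∈ h.sphere N, -(v * ℓ x + t * (w * ℓ' x - v * ℓ x))) / (h.sphere N).card =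
        -(v * N) + -(t * (w * h.avg ℓ' N - v * N)) := by
      have : ∑ x ∈ h.sphere N, -(v * ℓ x + t * (w * ℓ' x - v * ℓ x)) =
          ∑ x ∈ h.sphere N, ((-(v * N) + t * (v * N)) - t * w * ℓ' x) :=
        Finset.sum_congr rfl fun x hx => by rw [h.mem_sphere.1 hx]; ring
      rw [this, Finset.sum_sub_distrib, ← Finset.mul_sum, Finset.sum_const, nsmul_eq_mul,
        IsLength.avg]
      field_simp
      ring
    rw [e1, Real.exp_add, ← mul_assoc]
    refine le_mul_of_one_le_left (Real.exp_pos _).le ?_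
    rw [Real.exp_neg, ← div_eq_mul_inv, one_le_div (Real.exp_pos _)]
    exact hcard
  have hlow : ∀ᶠ N : ℕ in atTop, v / w + θ / (t * L * w) -
      Real.log ((L * N + 1) * A) / N / (t * w) ≤ h.avg ℓ' N / N := by
    filter_upwards [eventually_ge_atTop 1] with N hN
    have hN0 : (0 : ℝ) < N := by exact_mod_cast hN
    have h1 := key N
    rw [← mul_assoc, ← Real.le_log_iff_exp_le (by positivity),
      Real.log_mul (by positivity) (Real.exp_pos _).ne', Real.log_exp] at h1
    rw [← sub_nonneg]
    have e : h.avg ℓ' N / N - (v / w + θ / (t * L * w) -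
        Real.log ((L * N + 1) * A) / N / (t * w)) =
        (t * (w * h.avg ℓ' N - v * N) + Real.log ((L * N + 1) * A) - θ * (N / L)) /
          (N * t * w) := by
      field_simp
      ring
    rw [e]
    refine div_nonneg (by linarith) (by positivity)
  have hlim : Tendsto (fun N : ℕ => v / w + θ / (t * L * w) -
      Real.log ((L * N + 1) * A) / N / (t * w)) atTop (𝓝 (v / w + θ / (t * L * w))) := by
    simpa using tendsto_const_nhds.sub ((tendsto_log_div_atTop L A hL0' hA0).div_const (t * w))
  rw [← hlim.liminf_eq]
  have hbdd : IsBoundedUnder (· ≤ ·) atTop fun n : ℕ => h.avg ℓ' n / n :=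
    isBoundedUnder_of ⟨(L' : ℝ), h.avg_div_le hL''⟩
  exact liminf_le_liminf hlow hlim.isBoundedUnder_ge hbdd.isCoboundedUnder_ge

/-- For roughly similar length functions the mean distortion is the ratio. -/
lemma IsLength.tendsto_avg (hv : 0 < lenGrowth ℓ) {τ D : ℝ}
    (hτ : ∀ x, |(ℓ' x : ℝ) - τ * ℓ x| ≤ D) :
    Tendsto (fun n : ℕ => h.avg ℓ' n / n) atTop (𝓝 τ) := by
  have hbd : ∀ n : ℕ, |h.avg ℓ' n - τ * n| ≤ D := fun n => by
    have hcard := h.exp_le_card_sphere hv n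
    have hc0 : (0 : ℝ) < (h.sphere n).card := (Real.exp_pos _).trans_le hcard
    have e : h.avg ℓ' n - τ * n =
        (∑ x ∈ h.sphere n, ((ℓ' x : ℝ) - τ * ℓ x)) / (h.sphere n).card := by
      have : ∑ x ∈ h.sphere n, ((ℓ' x : ℝ) - τ * ℓ x) =
          ∑ x ∈ h.sphere n, ((ℓ' x : ℝ) - τ * n) :=
        Finset.sum_congr rfl fun x hx => by rw [h.mem_sphere.1 hx]
      rw [this, Finset.sum_sub_distrib, Finset.sum_const, nsmul_eq_mul, IsLength.avg]
      field_simp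
    rw [e, abs_div, abs_of_pos hc0, div_le_iff₀ hc0]
    refine (Finset.abs_sum_le_sum_abs _ _).trans
      ((Finset.sum_le_card_nsmul _ _ D fun x _ => hτ x).trans_eq ?_)
    rw [nsmul_eq_mul, mul_comm]
  rw [← tendsto_sub_nhds_zero_iff]
  refine squeeze_zero_norm' (a := fun n : ℕ => D / n) ?_ (tendsto_const_div_atTop_nhds_zero_nat D)
  filter_upwards [eventually_ge_atTop 1] with n hn
  have hn0 : (0 : ℝ) < n := by exact_mod_cast hn
  have e : h.avg ℓ' n / n - τ = (h.avg ℓ' n - τ * n) / n := by field_simp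
  rw [Real.norm_eq_abs, e, abs_div, abs_of_pos hn0]
  exact div_le_div_of_nonneg_right (hbd n) hn0.le

include h h' in
/-- A linear upper bound between length functions gives an inequality of growth rates. -/
lemma IsLength.lenGrowth_le_mul {τ D : ℝ} (hτ0 : 0 < τ) (hτ : ∀ x, (ℓ' x : ℝ) ≤ τ * ℓ x + D) :
    lenGrowth ℓ ≤ τ * lenGrowth ℓ' := by
  refine le_of_forall_gt_imp_ge_of_dense fun s hs => ?_
  have hs' : lenGrowth ℓ' < s / τ := by rwa [lt_div_iff₀ hτ0, mul_comm]
  have hs0 : 0 < s / τ := h'.lenGrowth_nonneg.trans_lt hs'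
  have hspos : 0 < s := by simpa [hτ0] using (div_pos_iff_of_pos_right hτ0).1 hs0
  refine h.lenGrowth_le_of_summable hspos.le ?_
  refine ((h'.summable_of_lenGrowth_lt hs').mul_left (Real.exp (s / τ * D))).of_nonneg_of_le
    (fun _ => (Real.exp_pos _).le) fun x => ?_
  rw [← Real.exp_add]
  refine Real.exp_le_exp.2 ?_
  have h1 := mul_le_mul_of_nonneg_left (hτ x) hs0.le
  have h2 : s / τ * (τ * ℓ x + D) = s * ℓ x + s / τ * D := by field_simp
  rw [h2] at h1
  linarith

include h h' in
lemma IsLength.lenGrowth_eq_mul {τ D : ℝ} (hτ0 : 0 < τ)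
    (hτ : ∀ x, |(ℓ' x : ℝ) - τ * ℓ x| ≤ D) : lenGrowth ℓ = τ * lenGrowth ℓ' := by
  refine le_antisymm (h.lenGrowth_le_mul h' hτ0 (D := D) fun x => ?_) ?_
  · have := (abs_le.1 (hτ x)).2
    linarith
  · have h1 : lenGrowth ℓ' ≤ τ⁻¹ * lenGrowth ℓ := by
      refine h'.lenGrowth_le_mul h (inv_pos.2 hτ0) (D := τ⁻¹ * D) fun x => ?_
      have := (abs_le.1 (hτ x)).1
      rw [← mul_add, le_inv_mul_iff₀ hτ0]
      linarith
    rwa [le_inv_mul_iff₀ hτ0] at h1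

end

lemma IsLength.exists_comparable {ℓ ℓ' : Γ → ℕ} (h : IsLength ℓ) (h' : IsLength ℓ') :
    ∃ L : ℕ, 0 < L ∧ (∀ x, ℓ x ≤ L * ℓ' x) ∧ ∀ x, ℓ' x ≤ L * ℓ x := by
  obtain ⟨L₁, hL₁⟩ := h.exists_le_mul (f := fun x => ℓ' x) (fun _ => Nat.cast_nonneg _)
    (by simp [h'.one]) fun x y => by exact_mod_cast h'.mul x y
  obtain ⟨L₂, hL₂⟩ := h'.exists_le_mul (f := fun x => ℓ x) (fun _ => Nat.cast_nonneg _)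
    (by simp [h.one]) fun x y => by exact_mod_cast h.mul x y
  refine ⟨L₁ + L₂ + 1, by omega, fun x => ?_, fun x => ?_⟩
  · have : ℓ x ≤ L₂ * ℓ' x := by exact_mod_cast hL₂ x
    exact this.trans (Nat.mul_le_mul_right _ (by omega))
  · have : ℓ' x ≤ L₁ * ℓ x := by exact_mod_cast hL₁ x
    exact this.trans (Nat.mul_le_mul_right _ (by omega))

lemma Connecting.goodWeight {ℓ ℓ' : Γ → ℕ} {δ D : ℕ} {u : Γ → Γ → Γ}
    (hc : Connecting ℓ δ D u) (h' : IsLength ℓ') :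
    GoodWeight ℓ fun x => lenGrowth ℓ' * ℓ' x := by
  have h := hc.len
  obtain ⟨L, -, hL, hL'⟩ := h.exists_comparable h'
  have hv := h'.lenGrowth_nonneg
  refine ⟨fun x => by positivity, fun x y => ?_, fun C => ?_, ?_⟩
  · rw [← mul_add]
    refine mul_le_mul_of_nonneg_left ?_ hv
    exact_mod_cast h'.mul x y
  · obtain ⟨C', hC'⟩ := h.quasi_additive hc.hyp h' L hL hL' C
    refine ⟨lenGrowth ℓ' * C', fun x y hxy => ?_⟩
    rw [← mul_add, ← mul_add]
    refine mul_le_mul_of_nonneg_left ?_ hv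
    exact_mod_cast hC' x y hxy
  · obtain ⟨K, hK⟩ := hc.exists_sum_sphere_lenGrowth_le h'
    refine ⟨K, fun n F hF => (Finset.sum_le_sum_of_subset_of_nonneg
      (fun x hx => h.mem_sphere.2 (hF x hx)) fun _ _ _ => (Real.exp_pos _).le).trans (hK n)⟩

/-- Rigidity of the mean distortion for length functions on a hyperbolic group. -/
theorem Connecting.liminf_avg {ℓ₀ ℓ ℓ' : Γ → ℕ} {δ D : ℕ} {u : Γ → Γ → Γ}
    (hc : Connecting ℓ₀ δ D u) (h : IsLength ℓ) (h' : IsLength ℓ')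
    (hΓ : ¬ ∃ H : Subgroup Γ, H.FiniteIndex ∧ ∃ g : Γ, H = Subgroup.zpowers g) :
    lenGrowth ℓ / lenGrowth ℓ' ≤ liminf (fun n : ℕ => h.avg ℓ' n / n) atTop ∧
    (liminf (fun n : ℕ => h.avg ℓ' n / n) atTop = lenGrowth ℓ / lenGrowth ℓ' ↔
      ∃ τ E : ℝ, 0 < τ ∧ 0 ≤ E ∧ ∀ x, |(ℓ' x : ℝ) - τ * ℓ x| ≤ E) := by
  have h₀ := hc.len
  have hv := hc.lenGrowth_pos h hΓ
  have hv' := hc.lenGrowth_pos h' hΓ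
  have hf := hc.goodWeight h
  have hf' := hc.goodWeight h'
  obtain ⟨L, hL0, hL, hL'⟩ := h₀.exists_comparable h
  obtain ⟨L', -, -, hL''⟩ := h.exists_comparable h'
  have hL0' : (0 : ℝ) < L := by exact_mod_cast hL0
  refine ⟨?_, fun heq => ?_, ?_⟩
  · obtain ⟨K, hK⟩ := hc.exists_sum_sphere_lenGrowth_le h'
    have := h.le_liminf_avg h₀ hL0 hL hL' hL'' hv hv' one_pos le_rfl (A := K) fun m => by
      have e := hK m
      simpa using e
    simpa using this
  · have hdecay : ∀ A θ : ℝ, 0 < θ → ¬ ∀ m : ℕ, ∑ x ∈ h₀.sphere m,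
        Real.exp (-((lenGrowth ℓ * ℓ x + lenGrowth ℓ' * ℓ' x) / 2)) ≤
          A * Real.exp (-(θ * m)) := by
      intro A θ hθ hA
      have := h.le_liminf_avg h₀ hL0 hL hL' hL'' hv hv' one_half_pos hθ.le (A := A) fun m => by
        refine le_trans (le_of_eq (Finset.sum_congr rfl fun x _ => ?_)) (hA m)
        congr 1
        ring
      rw [heq] at this
      have h2 : 0 < θ / (1 / 2 * L * lenGrowth ℓ') := by positivity
      linarith
    obtain ⟨C₁, hC₁⟩ : ∃ C : ℝ, ∀ x, lenGrowth ℓ' * ℓ' x - lenGrowth ℓ * ℓ x < C := by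
      by_contra! hgap
      obtain ⟨A, θ, hθ, hA⟩ := hc.exists_affinity_decay hf hf' hgap
      exact hdecay A θ hθ hA
    obtain ⟨C₂, hC₂⟩ : ∃ C : ℝ, ∀ x, lenGrowth ℓ * ℓ x - lenGrowth ℓ' * ℓ' x < C := by
      by_contra! hgap
      obtain ⟨A, θ, hθ, hA⟩ := hc.exists_affinity_decay hf' hf hgap
      simp only [add_comm (lenGrowth ℓ' * _)] at hA
      exact hdecay A θ hθ hA
    refine ⟨lenGrowth ℓ / lenGrowth ℓ', max 0 (max C₁ C₂) / lenGrowth ℓ', by positivity,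
      by positivity, fun x => ?_⟩
    rw [le_div_iff₀ hv', ← abs_of_pos hv', ← abs_mul, abs_of_pos hv', abs_le]
    have e : ((ℓ' x : ℝ) - lenGrowth ℓ / lenGrowth ℓ' * ℓ x) * lenGrowth ℓ' =
        lenGrowth ℓ' * ℓ' x - lenGrowth ℓ * ℓ x := by field_simp
    rw [e]
    have h1 := hC₁ x
    have h2 := hC₂ x
    have h3 : C₁ ≤ max 0 (max C₁ C₂) := (le_max_left _ _).trans (le_max_right _ _)
    have h4 : C₂ ≤ max 0 (max C₁ C₂) := (le_max_right _ _).trans (le_max_right _ _)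
    constructor <;> linarith
  · rintro ⟨τ, E, hτ, -, hE⟩
    rw [(h.tendsto_avg hv hE).liminf_eq, h.lenGrowth_eq_mul h' hτ hE]
    field_simp

lemma wordLength_le {S : Set Γ} {l : List Γ} (hl : ∀ a ∈ l, a ∈ S) :
    wordLength S l.prod ≤ l.length := Nat.sInf_le ⟨l, hl, rfl, rfl⟩

namespace IsSymmGen

variable {S : Set Γ} (hS : IsSymmGen S)
include hS

lemma exists_word (x : Γ) : ∃ l : List Γ, (∀ a ∈ l, a ∈ S) ∧ l.prod = x := by
  have hx : x ∈ (Subgroup.closure S).toSubmonoid := by rw [hS.2.2]; trivial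
  rw [Subgroup.closure_toSubmonoid] at hx
  obtain ⟨l, hl, rfl⟩ := Submonoid.exists_list_of_mem_closure hx
  refine ⟨l, fun a ha => ?_, rfl⟩
  rcases hl a ha with h | h
  · exact h
  · simpa using hS.2.1 _ h

lemma exists_minimal_word (x : Γ) :
    ∃ l : List Γ, (∀ a ∈ l, a ∈ S) ∧ l.length = wordLength S x ∧ l.prod = x := by
  obtain ⟨l, hl, hx⟩ := hS.exists_word x
  exact Nat.sInf_mem (s := {n : ℕ | ∃ l : List Γ, (∀ a ∈ l, a ∈ S) ∧ l.length = n ∧ l.prod = x})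
    ⟨l.length, l, hl, rfl, hx⟩

lemma wordLength_mul_le (x y : Γ) : wordLength S (x * y) ≤ wordLength S x + wordLength S y := by
  obtain ⟨l, hl, hlen, rfl⟩ := hS.exists_minimal_word x
  obtain ⟨l', hl', hlen', rfl⟩ := hS.exists_minimal_word y
  rw [← hlen, ← hlen', ← List.length_append, ← List.prod_append]
  refine wordLength_le fun a ha => ?_
  rcases List.mem_append.1 ha with h | h
  exacts [hl a h, hl' a h]

lemma isLength : IsLength (wordLength S) where
  one := by simpa using wordLength_le (S := S) (l := []) (by simp)
  eq_one x hx := by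
    obtain ⟨l, -, hlen, rfl⟩ := hS.exists_minimal_word x
    rw [hx, List.length_eq_zero_iff] at hlen
    simp [hlen]
  inv := by
    have key : ∀ x, wordLength S x⁻¹ ≤ wordLength S x := fun x => by
      obtain ⟨l, hl, hlen, rfl⟩ := hS.exists_minimal_word x
      rw [← hlen, List.prod_inv_reverse]
      refine (wordLength_le fun a ha => ?_).trans_eq (by simp)
      simp only [List.mem_reverse, List.mem_map] at ha
      obtain ⟨b, hb, rfl⟩ := ha
      exact hS.2.1 b (hl b hb)
    exact fun x => le_antisymm (key x) (by simpa using key x⁻¹)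
  mul := hS.wordLength_mul_le
  fin n := by
    have : Finite S := hS.1
    refine ((List.finite_length_le S n).image fun l => (l.map Subtype.val).prod).subset
      fun x hx => ?_
    obtain ⟨l, hl, hlen, rfl⟩ := hS.exists_minimal_word x
    refine ⟨l.attachWith (· ∈ S) hl, ?_, by simp⟩
    simpa [hlen] using hx
  split x i hi := by
    obtain ⟨l, hl, hlen, rfl⟩ := hS.exists_minimal_word x
    have h1 := wordLength_le (S := S) (l := l.take i) fun a ha => hl a (List.mem_of_mem_take ha)
    have h2 := wordLength_le (S := S) (l := l.drop i) fun a ha => hl a (List.mem_of_mem_drop ha)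
    have h3 := hS.wordLength_mul_le (l.take i).prod (l.drop i).prod
    rw [List.prod_take_mul_prod_drop] at h3
    rw [List.length_take] at h1
    rw [List.length_drop] at h2
    exact ⟨_, _, l.prod_take_mul_prod_drop i, by omega, by omega⟩

lemma exists_fourPoint (hyp : IsHyperbolicMetric (wordDist S)) :
    ∃ δ, FourPoint (wordLength S) δ := by
  obtain ⟨δ, -, hδ⟩ := hyp
  obtain ⟨n, hn⟩ := exists_nat_ge δ
  refine ⟨n, fun x y z w => ?_⟩
  have h := hδ w x y z
  have e : ∀ a b, wordDist S a b = (lenDist (wordLength S) a b : ℝ) := fun _ _ => rfl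
  simp only [gromov, e, hS.isLength.dist_comm w] at h
  rw [hS.isLength.dist_comm z y] at h
  rcases min_le_iff.1 (sub_le_iff_le_add.1 h) with h' | h'
  · left
    have : (lenDist (wordLength S) x y + lenDist (wordLength S) z w : ℝ) ≤
      lenDist (wordLength S) x z + lenDist (wordLength S) y w + 2 * n := by linarith
    exact_mod_cast this
  · right
    have : (lenDist (wordLength S) x y + lenDist (wordLength S) z w : ℝ) ≤
      lenDist (wordLength S) x w + lenDist (wordLength S) y z + 2 * n := by linarith
    exact_mod_cast this

lemma meanLen_eq (Sst : Set Γ) (n : ℕ) :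
    meanLen S Sst n = hS.isLength.avg (wordLength Sst) n := by
  rw [meanLen, sphCard, hS.isLength.card_sphere_eq, IsLength.avg]
  congr 1
  have e : ∀ x, wordLength S x = n ↔ x ∈ hS.isLength.sphere n := fun x =>
    hS.isLength.mem_sphere.symm
  rw [← Finset.tsum_subtype (hS.isLength.sphere n) fun x => (wordLength Sst x : ℝ)]
  exact (Equiv.subtypeEquivRight e).tsum_eq fun x => (wordLength Sst (x : Γ) : ℝ)

end IsSymmGen

lemma growthRate_wordDist (S : Set Γ) : growthRate (wordDist S) = lenGrowth (wordLength S) := by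
  simp only [growthRate, lenGrowth, wordDist, inv_one, one_mul, Nat.cast_le]

end HypFlow

namespace HypFlow

section Statements

open MeasureTheory Filter Topology
open scoped ENNReal

theorem stmt3 {Γ : Type*} [Group Γ]
    (hΓ : NonElemHyperbolic Γ)
    (S Sst : Set Γ) (hS : IsSymmGen S) (hSst : IsSymmGen Sst) :
    growthRate (wordDist S) / growthRate (wordDist Sst) ≤ meanDistortion S Sst ∧
    (meanDistortion S Sst = growthRate (wordDist S) / growthRate (wordDist Sst) ↔
      ∃ τ D : ℝ, 0 < τ ∧ 0 ≤ D ∧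
        ∀ x y : Γ, |wordDist Sst x y - τ * wordDist S x y| ≤ D) := by
  obtain ⟨⟨S₀, hS₀, hyp⟩, hcyc⟩ := hΓ
  obtain ⟨δ, hδ⟩ := hS₀.exists_fourPoint hyp
  obtain ⟨D, u, hc⟩ := hS₀.isLength.exists_connecting hδ hcyc
  have main := hc.liminf_avg hS.isLength hSst.isLength hcyc
  simp only [growthRate_wordDist, meanDistortion, hS.meanLen_eq]
  refine ⟨main.1, main.2.trans ?_⟩
  constructor
  · rintro ⟨τ, E, hτ, hE, h⟩
    exact ⟨τ, E, hτ, hE, fun x y => h (x⁻¹ * y)⟩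
  · rintro ⟨τ, E, hτ, hE, h⟩
    exact ⟨τ, E, hτ, hE, fun x => by simpa [wordDist] using h 1 x⟩

end Statements

end HypFlow
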